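/- Let a(n) denote the number of isomorphism classes of connected 3-regular permutation graphs on n vertices. For even n > 20, a(n) = a(n-4) + a(n-6) if n ≡ 2 (mod 4), and a(n) = a(n-4) + a(n-6) − t((n−20)/4) if n ≡ 0 (mod 4), where t(x) is the number of compositions of x into parts of size 2 or 3. -/

import Mathlib

def graphOfPerm {n : ℕ} (π : Equiv.Perm (Fin n)) : SimpleGraph (Fin n) :=
  SimpleGraph.fromRel (fun i j => i < j ∧ π j < π i)

def IsPermGraph {V : Type*} (G : SimpleGraph V) : Prop :=
  ∃ (n : ℕ) (π : Equiv.Perm (Fin n)), Nonempty (G ≃g graphOfPerm π)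

def IsRegular' {V : Type*} (G : SimpleGraph V) (r : ℕ) : Prop :=
  ∀ v, (G.neighborSet v).ncard = r

/-- Connected 3-regular permutation graphs on `n` vertices, up to isomorphism. -/
def cubicPermSetoid (n : ℕ) :
    Setoid {G : SimpleGraph (Fin n) // G.Connected ∧ IsRegular' G 3 ∧ IsPermGraph G} where
  r G H := Nonempty (G.1 ≃g H.1)
  iseqv := ⟨fun G => ⟨SimpleGraph.Iso.refl⟩, fun ⟨e⟩ => ⟨e.symm⟩,
    fun ⟨e⟩ ⟨e'⟩ => ⟨e.trans e'⟩⟩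

/-- `a n` is the number of isomorphism classes of connected 3-regular permutation
graphs on `n` vertices. -/
noncomputable def numCubicPerm (n : ℕ) : ℕ := Nat.card (Quotient (cubicPermSetoid n))

/-- `t x` is the number of compositions of `x` into parts of size 2 or 3. -/
noncomputable def numComp23 (x : ℕ) : ℕ :=
  Nat.card {l : List ℕ // (∀ p ∈ l, p = 2 ∨ p = 3) ∧ l.sum = x}

/-- The vertices of `G` carry positions `p` and values `q`, both bijections onto `{0, …, n - 1}`,
and adjacency means inversion. -/
structure IsRealizer {V : Type*} (G : SimpleGraph V) (n : ℕ) (p q : V → ℕ) : Prop where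
  p_lt : ∀ v, p v < n
  q_lt : ∀ v, q v < n
  p_inj : Function.Injective p
  q_inj : Function.Injective q
  p_surj : ∀ i < n, ∃ v, p v = i
  q_surj : ∀ i < n, ∃ v, q v = i
  adj_iff : ∀ u v, G.Adj u v ↔ (p u < p v ∧ q v < q u) ∨ (p v < p u ∧ q u < q v)

/-- The values at positions below `k` are those below `f` and those of the form `f + e`
with `e ∈ E`. -/
def UsedAt {V : Type*} (p q : V → ℕ) (n k f : ℕ) (E : Finset ℕ) : Prop :=
  (∀ v, p v < k ↔ (q v < f ∨ ∃ e ∈ E, q v = f + e)) ∧ ∀ e ∈ E, f + e < n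

/-- The relative values that may follow the set `E` of used relative values in a cubic
permutation. -/
def nextValues (E : Finset ℕ) : Finset ℕ :=
  (Finset.range (E.card + 4)).filter fun e =>
    e ∉ E ∧ (E.filter (e < ·)).card + ((Finset.range e).filter (· ∉ E)).card = 3 ∧
      ∀ x ∈ insert e E, ∀ g ∈ Finset.range x, g ∉ insert e E →
        ((insert e E).filter (g < ·)).card ≤ 3

section Realizer

variable {V : Type*} {G : SimpleGraph V} {n : ℕ} {p q : V → ℕ}

lemma IsRealizer.swap (h : IsRealizer G n p q) : IsRealizer G n q p where
  p_lt := h.q_lt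
  q_lt := h.p_lt
  p_inj := h.q_inj
  q_inj := h.p_inj
  p_surj := h.q_surj
  q_surj := h.p_surj
  adj_iff u v := by rw [h.adj_iff]; tauto

lemma IsRealizer.image_neighborSet (h : IsRealizer G n p q) {k f : ℕ} {E : Finset ℕ}
    (hU : UsedAt p q n k f E) {v : V} {e : ℕ} (hv : p v = k) (he : q v = f + e) :
    q '' G.neighborSet v =
      ↑((E.filter (e < ·) ∪ (Finset.range e).filter (· ∉ E)).image (f + ·)) := by
  ext x
  simp only [Set.mem_image, SimpleGraph.mem_neighborSet, Finset.coe_image, Finset.coe_union,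
    Finset.coe_filter, Set.mem_union, Set.mem_ofPred_eq, Finset.mem_range]
  constructor
  · rintro ⟨w, hw, rfl⟩
    rw [h.adj_iff] at hw
    rcases hw with ⟨h1, h2⟩ | ⟨h1, h2⟩
    · have h3 : ¬ p w < k := by omega
      rw [hU.1] at h3
      push Not at h3
      refine ⟨q w - f, Or.inr ⟨by omega, fun hE => h3.2 _ hE (by omega)⟩, by omega⟩
    · have h3 : p w < k := by omega
      rw [hU.1] at h3
      rcases h3 with h3 | ⟨x, hx, h3⟩
      · omega
      · exact ⟨x, Or.inl ⟨hx, by omega⟩, by omega⟩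
  · rintro ⟨x, ⟨hx, hex⟩ | ⟨hx, hxE⟩, rfl⟩
    · obtain ⟨w, hw⟩ := h.q_surj _ (hU.2 x hx)
      refine ⟨w, ?_, hw⟩
      have := (hU.1 w).2 (Or.inr ⟨x, hx, hw⟩)
      rw [h.adj_iff]
      omega
    · obtain ⟨w, hw⟩ := h.q_surj (f + x) (by have := h.q_lt v; omega)
      refine ⟨w, ?_, hw⟩
      have h1 : ¬ p w < k := by
        rw [hU.1]
        rintro (h2 | ⟨y, hy, h2⟩)
        · omega
        · obtain rfl : y = x := by omega
          exact hxE hy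
      have h2 : p w ≠ p v := fun h3 => by have := h.p_inj h3; subst this; omega
      rw [h.adj_iff]
      omega

lemma IsRealizer.count (h : IsRealizer G n p q) (hG : ∀ v, (G.neighborSet v).ncard = 3)
    {k f : ℕ} {E : Finset ℕ} (hU : UsedAt p q n k f E) {v : V} {e : ℕ} (hv : p v = k)
    (he : q v = f + e) :
    (E.filter (e < ·)).card + ((Finset.range e).filter (· ∉ E)).card = 3 := by
  rw [← hG v, ← Set.ncard_image_of_injective _ h.q_inj, h.image_neighborSet hU hv he,
    Set.ncard_coe_finset, Finset.card_image_of_injective _ (add_right_injective f),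
    Finset.card_union_of_disjoint]
  rw [Finset.disjoint_left]
  grind

lemma IsRealizer.card_filter_le (h : IsRealizer G n p q) [Finite V]
    (hG : ∀ v, (G.neighborSet v).ncard = 3) {k f : ℕ} {E : Finset ℕ} (hU : UsedAt p q n k f E)
    {g : ℕ} (hg : f + g < n) (hgE : g ∉ E) : (E.filter (g < ·)).card ≤ 3 := by
  obtain ⟨v, hv⟩ := h.q_surj _ hg
  have h1 : ¬ p v < k := by
    rw [hU.1]
    rintro (h2 | ⟨y, hy, h2⟩)
    · omega
    · obtain rfl : y = g := by omega
      exact hgE hy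
  rw [← hG v, ← Set.ncard_image_of_injective _ h.q_inj,
    ← Finset.card_image_of_injective _ (add_right_injective f), ← Set.ncard_coe_finset]
  refine Set.ncard_le_ncard ?_ (Set.toFinite _)
  intro x hx
  simp only [Finset.coe_image, Finset.coe_filter, Set.mem_image, Set.mem_ofPred_eq] at hx
  obtain ⟨x, ⟨hx, hgx⟩, rfl⟩ := hx
  obtain ⟨w, hw⟩ := h.q_surj _ (hU.2 x hx)
  refine ⟨w, ?_, hw⟩
  have := (hU.1 w).2 (Or.inr ⟨x, hx, hw⟩)
  rw [SimpleGraph.mem_neighborSet, h.adj_iff]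
  omega

lemma IsRealizer.exists_next (h : IsRealizer G n p q) [Finite V]
    (hG : ∀ v, (G.neighborSet v).ncard = 3) {k f : ℕ} {E : Finset ℕ} (hU : UsedAt p q n k f E)
    (hk : k < n) :
    ∃ v, ∃ e ∈ nextValues E, p v = k ∧ q v = f + e ∧ UsedAt p q n (k + 1) f (insert e E) := by
  obtain ⟨v, hv⟩ := h.p_surj k hk
  have h1 : ¬ p v < k := by omega
  rw [hU.1] at h1
  push Not at h1
  obtain ⟨e, he⟩ := Nat.exists_eq_add_of_le h1.1
  have heE : e ∉ E := fun h2 => h1.2 e h2 he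
  have hU' : UsedAt p q n (k + 1) f (insert e E) := by
    refine ⟨fun w => ?_, fun x hx => ?_⟩
    · rw [Nat.lt_succ_iff_lt_or_eq, hU.1]
      have : p w = k ↔ q w = f + e := by
        rw [← hv, ← he]
        exact h.p_inj.eq_iff.trans h.q_inj.eq_iff.symm
      rw [this]
      simp only [Finset.mem_insert, exists_eq_or_imp]
      rw [or_assoc, or_comm (b := q w = f + e)]
    · rcases Finset.mem_insert.1 hx with rfl | hx
      · rw [← he]; exact h.q_lt v
      · exact hU.2 x hx
  have hc := h.count hG hU hv he
  refine ⟨v, e, ?_, hv, he, hU'⟩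
  rw [nextValues, Finset.mem_filter, Finset.mem_range]
  refine ⟨?_, heE, hc, fun x hx g hg hgE => ?_⟩
  · have h2 := Finset.card_filter_add_card_filter_not (s := Finset.range e) (fun x => x ∈ E)
    have h3 : ((Finset.range e).filter (· ∈ E)).card ≤ E.card :=
      Finset.card_le_card fun x hx => (Finset.mem_filter.1 hx).2
    rw [Finset.card_range] at h2
    omega
  · refine h.card_filter_le hG hU' ?_ hgE
    have := hU'.2 x hx
    have := Finset.mem_range.1 hg
    omega

lemma IsRealizer.lt_of_gap (h : IsRealizer G n p q) {k f : ℕ} {E : Finset ℕ}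
    (hU : UsedAt p q n k f E) (hE : ∃ e ∈ E, ∃ g ∈ Finset.range e, g ∉ E) : k < n := by
  obtain ⟨e, he, g, hg, hgE⟩ := hE
  have h1 := hU.2 e he
  have h2 := Finset.mem_range.1 hg
  obtain ⟨v, hv⟩ := h.q_surj (f + g) (by omega)
  have h3 : ¬ p v < k := by
    rw [hU.1]
    rintro (h2 | ⟨y, hy, h2⟩)
    · omega
    · obtain rfl : y = g := by omega
      exact hgE hy
  have := h.p_lt v
  omega

lemma IsRealizer.le_of_lower (h : IsRealizer G n p q) (hc : G.Connected) {k : ℕ} (hk : 0 < k)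
    (hU : ∀ v, p v < k ↔ q v < k) : n ≤ k := by
  by_contra! hkn
  obtain ⟨u, hu⟩ := h.p_surj 0 (by omega)
  obtain ⟨v, hv⟩ := h.p_surj k hkn
  have key : ∀ a b, G.Walk a b → p a < k → p b < k := by
    intro a b w
    induction w with
    | nil => exact id
    | @cons a b c hab w ih =>
      intro ha
      apply ih
      rw [h.adj_iff] at hab
      have h1 := hU a
      have h2 := hU b
      omega
  obtain ⟨w⟩ := hc.preconnected u v
  have := key u v w (by omega)
  omega

lemma adj_iff_of_three (hG : ∀ v, (G.neighborSet v).ncard = 3) {v x y z : V}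
    (hx : G.Adj v x) (hy : G.Adj v y) (hz : G.Adj v z) (hxy : x ≠ y) (hxz : x ≠ z) (hyz : y ≠ z)
    (w : V) : G.Adj v w ↔ w = x ∨ w = y ∨ w = z := by
  have hfin : (G.neighborSet v).Finite := Set.finite_of_ncard_ne_zero (by rw [hG]; norm_num)
  have : ({x, y, z} : Set V) = G.neighborSet v := by
    refine Set.eq_of_subset_of_ncard_le ?_ ?_ hfin
    · rintro w (rfl | rfl | rfl) <;> assumption
    · rw [hG, Set.ncard_eq_three.2 ⟨x, y, z, hxy, hxz, hyz, rfl⟩]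
  rw [← SimpleGraph.mem_neighborSet, ← this]
  simp

lemma IsRealizer.adj_of_eq (h : IsRealizer G n p q) {f i j i' j' : ℕ} {v w : V}
    (hv : p v = f + i ∧ q v = f + j) (hw : p w = f + i' ∧ q w = f + j')
    (hij : (i < i' ∧ j' < j) ∨ (i' < i ∧ j < j')) : G.Adj v w := by
  rw [h.adj_iff, hv.1, hv.2, hw.1, hw.2]
  omega

lemma adj_iff_of_three_values (hG : ∀ v, (G.neighborSet v).ncard = 3) {v x y z : V}
    {f i j k : ℕ} (hx : G.Adj v x) (hy : G.Adj v y) (hz : G.Adj v z) (hxq : q x = f + i)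
    (hyq : q y = f + j) (hzq : q z = f + k) (hd : i ≠ j ∧ i ≠ k ∧ j ≠ k) (w : V) :
    G.Adj v w ↔ w = x ∨ w = y ∨ w = z := by
  refine adj_iff_of_three hG hx hy hz ?_ ?_ ?_ w
  · rintro rfl; omega
  · rintro rfl; omega
  · rintro rfl; omega

lemma IsRealizer.exists_next_eq (h : IsRealizer G n p q) [Finite V]
    (hG : ∀ v, (G.neighborSet v).ncard = 3) {k f : ℕ} {E : Finset ℕ} (hU : UsedAt p q n k f E)
    (hk : k < n) {e : ℕ} (hE : nextValues E = {e}) :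
    ∃ v, p v = k ∧ q v = f + e ∧ UsedAt p q n (k + 1) f (insert e E) := by
  obtain ⟨v, e', he, h⟩ := h.exists_next hG hU hk
  rw [hE, Finset.mem_singleton] at he
  exact ⟨v, he ▸ h⟩

lemma IsRealizer.exists_next_pair (h : IsRealizer G n p q) [Finite V]
    (hG : ∀ v, (G.neighborSet v).ncard = 3) {k f : ℕ} {E : Finset ℕ} (hU : UsedAt p q n k f E)
    (hk : k < n) {e₁ e₂ : ℕ} (hE : nextValues E = {e₁, e₂}) :
    (∃ v, p v = k ∧ q v = f + e₁ ∧ UsedAt p q n (k + 1) f (insert e₁ E)) ∨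
      ∃ v, p v = k ∧ q v = f + e₂ ∧ UsedAt p q n (k + 1) f (insert e₂ E) := by
  obtain ⟨v, e', he, h⟩ := h.exists_next hG hU hk
  rw [hE, Finset.mem_insert, Finset.mem_singleton] at he
  rcases he with rfl | rfl
  exacts [Or.inl ⟨v, h⟩, Or.inr ⟨v, h⟩]

end Realizer

/-- The three kinds of layers: one vertex, two nonadjacent vertices, two adjacent vertices. -/
inductive Layer
  | single
  | indep
  | clique

instance : DecidableEq Layer := fun a b => by
  cases a <;> cases b <;> first | exact isTrue rfl | exact isFalse (by simp)

/-- The layers of the block coded by a part: a diamond for `2`, and `K₃,₃` minus an edge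
otherwise. -/
def blockWord (x : ℕ) : List Layer :=
  if x = 2 then [.single, .clique, .single] else [.single, .indep, .indep, .single]

/-- The layers of a chain of blocks together with its right end. -/
def tailWord (l : List ℕ) : List Layer :=
  l.flatMap blockWord ++ [.single, .indep, .clique]

/-- The layers of a chain of blocks together with both ends. -/
def chainWord (l : List ℕ) : List Layer :=
  [.clique, .indep, .single] ++ tailWord l

lemma tailWord_two (l : List ℕ) :
    tailWord (2 :: l) = .single :: .clique :: .single :: tailWord l := rfl

lemma tailWord_three (l : List ℕ) :
    tailWord (3 :: l) = .single :: .indep :: .indep :: .single :: tailWord l := rfl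

section Layering

variable {V : Type*}

/-- The vertices of the first layer. -/
def headVerts : List (Layer × V × V) → List V
  | [] => []
  | (_, x, y) :: _ => [x, y]

/-- `IsLayering G prev L` says that every vertex of a layer of `L` is adjacent to exactly the
vertices of the two neighbouring layers, and to its companion if its layer is a clique;
`prev` is the layer before the first one. -/
def IsLayering (G : SimpleGraph V) : List V → List (Layer × V × V) → Prop
  | _, [] => True
  | prev, (s, x, y) :: r =>
      (∀ v, G.Adj x v ↔ v ∈ prev ∨ v ∈ headVerts r ∨ (s = .clique ∧ v = y)) ∧
      (∀ v, G.Adj y v ↔ v ∈ prev ∨ v ∈ headVerts r ∨ (s = .clique ∧ v = x)) ∧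
      (s = .single → x = y) ∧ IsLayering G [x, y] r

lemma headVerts_nil : headVerts ([] : List (Layer × V × V)) = [] := rfl

lemma headVerts_cons (s : Layer) (x y : V) (r : List (Layer × V × V)) :
    headVerts ((s, x, y) :: r) = [x, y] := rfl

lemma isLayering_nil (G : SimpleGraph V) (prev : List V) : IsLayering G prev [] := trivial

lemma isLayering_cons (G : SimpleGraph V) (prev : List V) (s : Layer) (x y : V)
    (r : List (Layer × V × V)) : IsLayering G prev ((s, x, y) :: r) ↔
      (∀ v, G.Adj x v ↔ v ∈ prev ∨ v ∈ headVerts r ∨ (s = .clique ∧ v = y)) ∧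
      (∀ v, G.Adj y v ↔ v ∈ prev ∨ v ∈ headVerts r ∨ (s = .clique ∧ v = x)) ∧
      (s = .single → x = y) ∧ IsLayering G [x, y] r := Iff.rfl

lemma isLayering_diamond {G : SimpleGraph V} {u c a b d g : V} {L : List (Layer × V × V)}
    (Hc : ∀ v, G.Adj c v ↔ v = u ∨ v = a ∨ v = b) (Ha : ∀ v, G.Adj a v ↔ v = c ∨ v = b ∨ v = d)
    (Hb : ∀ v, G.Adj b v ↔ v = c ∨ v = a ∨ v = d) (Hd : ∀ v, G.Adj d v ↔ v = a ∨ v = b ∨ v = g)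
    (hh : headVerts L = [g, g]) (hL : IsLayering G [d, d] L) :
    IsLayering G [u, u] ((.single, c, c) :: (.clique, a, b) :: (.single, d, d) :: L) := by
  simp only [isLayering_cons, headVerts_cons, hh, hL, Hc, Ha, Hb, Hd, List.mem_cons,
    List.not_mem_nil, reduceCtorEq]
  refine ⟨?_, ?_, ?_, ?_, ?_, ?_, ?_, ?_, ?_, ?_⟩ <;> tauto

lemma isLayering_bipartite {G : SimpleGraph V} {u c a b x y d g : V} {L : List (Layer × V × V)}
    (Hc : ∀ v, G.Adj c v ↔ v = u ∨ v = a ∨ v = b) (Ha : ∀ v, G.Adj a v ↔ v = c ∨ v = x ∨ v = y)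
    (Hb : ∀ v, G.Adj b v ↔ v = c ∨ v = x ∨ v = y) (Hx : ∀ v, G.Adj x v ↔ v = a ∨ v = b ∨ v = d)
    (Hy : ∀ v, G.Adj y v ↔ v = a ∨ v = b ∨ v = d) (Hd : ∀ v, G.Adj d v ↔ v = x ∨ v = y ∨ v = g)
    (hh : headVerts L = [g, g]) (hL : IsLayering G [d, d] L) :
    IsLayering G [u, u]
      ((.single, c, c) :: (.indep, a, b) :: (.indep, x, y) :: (.single, d, d) :: L) := by
  simp only [isLayering_cons, headVerts_cons, hh, hL, Hc, Ha, Hb, Hx, Hy, Hd, List.mem_cons,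
    List.not_mem_nil, reduceCtorEq]
  refine ⟨?_, ?_, ?_, ?_, ?_, ?_, ?_, ?_, ?_, ?_, ?_, ?_, ?_⟩ <;> tauto

lemma isLayering_end {G : SimpleGraph V} {u c a b x y : V}
    (Hc : ∀ v, G.Adj c v ↔ v = u ∨ v = a ∨ v = b) (Ha : ∀ v, G.Adj a v ↔ v = c ∨ v = x ∨ v = y)
    (Hb : ∀ v, G.Adj b v ↔ v = c ∨ v = x ∨ v = y) (Hx : ∀ v, G.Adj x v ↔ v = a ∨ v = b ∨ v = y)
    (Hy : ∀ v, G.Adj y v ↔ v = a ∨ v = b ∨ v = x) :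
    IsLayering G [u, u] [(.single, c, c), (.indep, a, b), (.clique, x, y)] := by
  simp only [isLayering_cons, isLayering_nil, headVerts_cons, headVerts_nil, Hc, Ha, Hb, Hx, Hy,
    List.mem_cons, List.not_mem_nil, reduceCtorEq]
  refine ⟨?_, ?_, ?_, ?_, ?_, ?_, ?_, ?_, ?_⟩ <;> tauto

lemma isLayering_start {G : SimpleGraph V} {x y a b u c : V} {L : List (Layer × V × V)}
    (Hx : ∀ v, G.Adj x v ↔ v = y ∨ v = a ∨ v = b) (Hy : ∀ v, G.Adj y v ↔ v = x ∨ v = a ∨ v = b)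
    (Ha : ∀ v, G.Adj a v ↔ v = x ∨ v = y ∨ v = u) (Hb : ∀ v, G.Adj b v ↔ v = x ∨ v = y ∨ v = u)
    (Hu : ∀ v, G.Adj u v ↔ v = a ∨ v = b ∨ v = c)
    (hh : headVerts L = [c, c]) (hL : IsLayering G [u, u] L) :
    IsLayering G [] ((.clique, x, y) :: (.indep, a, b) :: (.single, u, u) :: L) := by
  simp only [isLayering_cons, headVerts_cons, hh, hL, Hx, Hy, Ha, Hb, Hu, List.mem_cons,
    List.not_mem_nil, reduceCtorEq]
  refine ⟨?_, ?_, ?_, ?_, ?_, ?_, ?_, ?_, ?_, ?_⟩ <;> tauto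

lemma UsedAt.after_diamond {p q : V → ℕ} {n f : ℕ}
    (hU : UsedAt p q n (f + 6) f {2, 7, 0, 3, 4, 1}) (h4 : ∀ v, p v = f + 4 ↔ q v = f + 7)
    (hn : f + 5 < n) : UsedAt q p n (f + 5) (f + 4) {1} := by
  refine ⟨fun v => ?_, by simpa using hn⟩
  have h1 := hU.1 v
  have h2 := h4 v
  simp only [Finset.mem_insert, Finset.mem_singleton, exists_eq_or_imp, exists_eq_left] at h1 ⊢
  clear hU h4
  constructor
  · intro hq
    have h3 := h1.2 (by omega)
    have h4 : p v ≠ f + 4 := fun h => by have := h2.1 h; omega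
    omega
  · intro hp
    have h3 := h1.1 (by omega)
    have h4 : q v ≠ f + 7 := fun h => by have := h2.2 h; omega
    omega

lemma UsedAt.after_bipartite {p q : V → ℕ} {n f : ℕ}
    (hU : UsedAt p q n (f + 7) f {3, 2, 7, 0, 5, 4, 1}) :
    UsedAt p q n (f + 7) (f + 6) {1} := by
  refine ⟨fun v => ?_, by simpa using hU.2 7 (by simp)⟩
  have h1 := hU.1 v
  simp only [Finset.mem_insert, Finset.mem_singleton, exists_eq_or_imp, exists_eq_left] at h1 ⊢
  rw [h1]
  omega

lemma UsedAt.lower_of_end {p q : V → ℕ} {n f : ℕ}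
    (hU : UsedAt p q n (f + 6) f {2, 3, 0, 5, 4, 1}) (v : V) : p v < f + 6 ↔ q v < f + 6 := by
  have h1 := hU.1 v
  simp only [Finset.mem_insert, Finset.mem_singleton, exists_eq_or_imp, exists_eq_left] at h1 ⊢
  rw [h1]
  omega

lemma exists_tail_layering [Finite V] {G : SimpleGraph V} {n : ℕ} (hc : G.Connected)
    (hG : ∀ v, (G.neighborSet v).ncard = 3) (N : ℕ) :
    ∀ (f : ℕ) (p q : V → ℕ), n ≤ f + N → IsRealizer G n p q → UsedAt p q n (f + 1) f {1} →
      ∀ u c, q u = f + 1 → q c = f →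
        ∃ (l : List ℕ) (L : List (Layer × V × V)), (∀ x ∈ l, x = 2 ∨ x = 3) ∧
          n = f + 6 + 2 * l.sum ∧ L.map Prod.fst = tailWord l ∧ headVerts L = [c, c] ∧
          IsLayering G [u, u] L := by
  induction N with
  | zero =>
    intro f p q hN h _ u c _ hc
    have := h.q_lt c
    omega
  | succ N ih =>
    intro f p q hN h U u c hu hqc
    have hpu : p u < f + 1 := (U.1 u).2 (Or.inr ⟨1, by simp, hu⟩)
    obtain ⟨a, hap, haq, U⟩ := h.exists_next_eq hG U (h.lt_of_gap U (by decide))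
      (e := 4) (by decide +kernel)
    have hfa : f + 4 < n := haq ▸ h.q_lt a
    have ha : p a = f + 1 ∧ q a = f + 4 := ⟨hap, haq⟩
    rcases h.exists_next_pair hG U (h.lt_of_gap U (by decide)) (e₁ := 3) (e₂ := 5) (by decide +kernel) with
      ⟨b, hbp, hbq, U⟩ | ⟨b, hbp, hbq, U⟩
    · have hb : p b = f + 2 ∧ q b = f + 3 := ⟨hbp, hbq⟩
      obtain ⟨c', hcp, hcq, U⟩ := h.exists_next_eq hG U (h.lt_of_gap U (by decide))
        (e := 0) (by decide +kernel)
      obtain rfl : c' = c := h.q_inj (hcq.trans hqc.symm)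
      have hc : p c' = f + 3 ∧ q c' = f + 0 := ⟨hcp, hcq⟩
      obtain ⟨g, hgp, hgq, U⟩ := h.exists_next_eq hG U (h.lt_of_gap U (by decide))
        (e := 7) (by decide +kernel)
      have hg : p g = f + 4 ∧ q g = f + 7 := ⟨hgp, hgq⟩
      obtain ⟨d, hdp, hdq, U⟩ := h.exists_next_eq hG U (h.lt_of_gap U (by decide))
        (e := 2) (by decide +kernel)
      have hd : p d = f + 5 ∧ q d = f + 2 := ⟨hdp, hdq⟩
      have U' := U.after_diamond (fun v => by
        rw [← hg.1, ← hg.2]; exact h.p_inj.eq_iff.trans h.q_inj.eq_iff.symm) (hd.1 ▸ h.p_lt d)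
      obtain ⟨l, L, hl, hn, hL, hh, hLay⟩ := ih (f + 4) q p (by clear * - hN; omega) h.swap U' d g
        hd.1 hg.1
      have Hc := adj_iff_of_three_values (q := q) hG (v := c') (x := u) (y := a) (z := b)
        ((h.adj_iff _ _).2 (Or.inr ⟨by rw [hcp]; omega, by rw [hcq, hu]; simp⟩))
        (h.adj_of_eq hc ha (by decide)) (h.adj_of_eq hc hb (by decide)) hu haq hbq (by decide)
      have Ha := adj_iff_of_three_values (q := q) hG (v := a) (x := c') (y := b) (z := d)
        (h.adj_of_eq ha hc (by decide)) (h.adj_of_eq ha hb (by decide))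
        (h.adj_of_eq ha hd (by decide)) hcq hbq hdq (by decide)
      have Hb := adj_iff_of_three_values (q := q) hG (v := b) (x := c') (y := a) (z := d)
        (h.adj_of_eq hb hc (by decide)) (h.adj_of_eq hb ha (by decide))
        (h.adj_of_eq hb hd (by decide)) hcq haq hdq (by decide)
      have Hd := adj_iff_of_three_values (q := q) hG (v := d) (x := a) (y := b) (z := g)
        (h.adj_of_eq hd ha (by decide)) (h.adj_of_eq hd hb (by decide))
        (h.adj_of_eq hd hg (by decide)) haq hbq hgq (by decide)
      refine ⟨2 :: l, (.single, c', c') :: (.clique, a, b) :: (.single, d, d) :: L, by simpa using hl,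
        ?_, by simp [hL, tailWord_two], rfl, isLayering_diamond Hc Ha Hb Hd hh hLay⟩
      rw [List.sum_cons, hn]
      ring
    · have hb : p b = f + 2 ∧ q b = f + 5 := ⟨hbp, hbq⟩
      obtain ⟨c', hcp, hcq, U⟩ := h.exists_next_eq hG U (h.lt_of_gap U (by decide))
        (e := 0) (by decide +kernel)
      obtain rfl : c' = c := h.q_inj (hcq.trans hqc.symm)
      have hc' : p c' = f + 3 ∧ q c' = f + 0 := ⟨hcp, hcq⟩
      have Hc := adj_iff_of_three_values (q := q) hG (v := c') (x := u) (y := a) (z := b)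
        ((h.adj_iff _ _).2 (Or.inr ⟨by rw [hcp]; omega, by rw [hcq, hu]; simp⟩))
        (h.adj_of_eq hc' ha (by decide)) (h.adj_of_eq hc' hb (by decide)) hu haq hbq (by decide)
      rcases h.exists_next_pair hG U (h.lt_of_gap U (by decide)) (e₁ := 3) (e₂ := 7)
        (by decide +kernel) with ⟨d, hdp, hdq, U⟩ | ⟨d, hdp, hdq, U⟩
      · have hd : p d = f + 4 ∧ q d = f + 3 := ⟨hdp, hdq⟩
        obtain ⟨y, hyp, hyq, U⟩ := h.exists_next_eq hG U (h.lt_of_gap U (by decide))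
          (e := 2) (by decide +kernel)
        have hy : p y = f + 5 ∧ q y = f + 2 := ⟨hyp, hyq⟩
        have hn : n ≤ f + 6 := h.le_of_lower hc (Nat.succ_pos _) U.lower_of_end
        have Ha := adj_iff_of_three_values (q := q) hG (v := a) (x := c') (y := d) (z := y)
          (h.adj_of_eq ha hc' (by decide)) (h.adj_of_eq ha hd (by decide))
          (h.adj_of_eq ha hy (by decide)) hcq hdq hyq (by decide)
        have Hb := adj_iff_of_three_values (q := q) hG (v := b) (x := c') (y := d) (z := y)
          (h.adj_of_eq hb hc' (by decide)) (h.adj_of_eq hb hd (by decide))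
          (h.adj_of_eq hb hy (by decide)) hcq hdq hyq (by decide)
        have Hd := adj_iff_of_three_values (q := q) hG (v := d) (x := a) (y := b) (z := y)
          (h.adj_of_eq hd ha (by decide)) (h.adj_of_eq hd hb (by decide))
          (h.adj_of_eq hd hy (by decide)) haq hbq hyq (by decide)
        have Hy := adj_iff_of_three_values (q := q) hG (v := y) (x := a) (y := b) (z := d)
          (h.adj_of_eq hy ha (by decide)) (h.adj_of_eq hy hb (by decide))
          (h.adj_of_eq hy hd (by decide)) haq hbq hdq (by decide)
        refine ⟨[], [(.single, c', c'), (.indep, a, b), (.clique, d, y)], by simp, ?_, rfl, rfl,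
          isLayering_end Hc Ha Hb Hd Hy⟩
        exact le_antisymm hn (by have := h.p_lt y; rw [hyp] at this; exact this)
      · have hd : p d = f + 4 ∧ q d = f + 7 := ⟨hdp, hdq⟩
        obtain ⟨x, hxp, hxq, U⟩ := h.exists_next_eq hG U (h.lt_of_gap U (by decide))
          (e := 2) (by decide +kernel)
        have hx : p x = f + 5 ∧ q x = f + 2 := ⟨hxp, hxq⟩
        obtain ⟨y, hyp, hyq, U⟩ := h.exists_next_eq hG U (h.lt_of_gap U (by decide))
          (e := 3) (by decide +kernel)
        have hy : p y = f + 6 ∧ q y = f + 3 := ⟨hyp, hyq⟩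
        have U' := U.after_bipartite
        obtain ⟨g, hgq⟩ := h.q_surj (f + 6) (by have := h.q_lt d; rw [hdq] at this; clear * - this; omega)
        have hgp : ¬ p g < f + 6 + 1 := by
          rw [U'.1, hgq]
          simp
        obtain ⟨l, L, hl, hn, hL, hh, hLay⟩ := ih (f + 6) p q (by clear * - hN; omega) h U'
          d g hdq hgq
        have Ha := adj_iff_of_three_values (q := q) hG (v := a) (x := c') (y := x) (z := y)
          (h.adj_of_eq ha hc' (by decide)) (h.adj_of_eq ha hx (by decide))
          (h.adj_of_eq ha hy (by decide)) hcq hxq hyq (by decide)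
        have Hb := adj_iff_of_three_values (q := q) hG (v := b) (x := c') (y := x) (z := y)
          (h.adj_of_eq hb hc' (by decide)) (h.adj_of_eq hb hx (by decide))
          (h.adj_of_eq hb hy (by decide)) hcq hxq hyq (by decide)
        have Hx := adj_iff_of_three_values (q := q) hG (v := x) (x := a) (y := b) (z := d)
          (h.adj_of_eq hx ha (by decide)) (h.adj_of_eq hx hb (by decide))
          (h.adj_of_eq hx hd (by decide)) haq hbq hdq (by decide)
        have Hy := adj_iff_of_three_values (q := q) hG (v := y) (x := a) (y := b) (z := d)
          (h.adj_of_eq hy ha (by decide)) (h.adj_of_eq hy hb (by decide))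
          (h.adj_of_eq hy hd (by decide)) haq hbq hdq (by decide)
        have Hd := adj_iff_of_three_values (q := q) hG (v := d) (x := x) (y := y) (z := g)
          (h.adj_of_eq hd hx (by decide)) (h.adj_of_eq hd hy (by decide))
          ((h.adj_iff _ _).2 (Or.inl ⟨by rw [hd.1]; clear * - hgp; omega, by rw [hd.2, hgq]; simp⟩))
          hxq hyq hgq (by decide)
        refine ⟨3 :: l, (.single, c', c') :: (.indep, a, b) :: (.indep, x, y) :: (.single, d, d) :: L,
          by simpa using hl, ?_, by simp [hL, tailWord_three], rfl,
          isLayering_bipartite Hc Ha Hb Hx Hy Hd hh hLay⟩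
        rw [List.sum_cons, hn]
        ring

lemma exists_layering_of_start [Finite V] {G : SimpleGraph V} {n : ℕ} {p q : V → ℕ}
    (hc : G.Connected) (hG : ∀ v, (G.neighborSet v).ncard = 3) (h : IsRealizer G n p q)
    (U : UsedAt p q n 5 4 {1}) {x y u a b : V} (hx : p x = 0 + 0 ∧ q x = 0 + 3)
    (hy : p y = 0 + 1 ∧ q y = 0 + 2) (hu : p u = 0 + 2 ∧ q u = 0 + 5)
    (ha : p a = 0 + 3 ∧ q a = 0 + 0) (hb : p b = 0 + 4 ∧ q b = 0 + 1) :
    ∃ (l : List ℕ) (L : List (Layer × V × V)), (∀ x ∈ l, x = 2 ∨ x = 3) ∧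
      n = 10 + 2 * l.sum ∧ L.map Prod.fst = chainWord l ∧ IsLayering G [] L := by
  obtain ⟨c, hcq⟩ := h.q_surj 4 (by have := h.q_lt u; rw [hu.2] at this; omega)
  have hcp : ¬ p c < 5 := by
    rw [U.1, hcq]
    simp
  obtain ⟨l, L, hl, hn, hL, hh, hLay⟩ := exists_tail_layering hc hG n 4 p q (by omega) h U u c
    hu.2 hcq
  have Hx := adj_iff_of_three_values (q := q) hG (v := x) (x := y) (y := a) (z := b)
    (h.adj_of_eq hx hy (by decide)) (h.adj_of_eq hx ha (by decide))
    (h.adj_of_eq hx hb (by decide)) hy.2 ha.2 hb.2 (by decide)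
  have Hy := adj_iff_of_three_values (q := q) hG (v := y) (x := x) (y := a) (z := b)
    (h.adj_of_eq hy hx (by decide)) (h.adj_of_eq hy ha (by decide))
    (h.adj_of_eq hy hb (by decide)) hx.2 ha.2 hb.2 (by decide)
  have Ha := adj_iff_of_three_values (q := q) hG (v := a) (x := x) (y := y) (z := u)
    (h.adj_of_eq ha hx (by decide)) (h.adj_of_eq ha hy (by decide))
    (h.adj_of_eq ha hu (by decide)) hx.2 hy.2 hu.2 (by decide)
  have Hb := adj_iff_of_three_values (q := q) hG (v := b) (x := x) (y := y) (z := u)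
    (h.adj_of_eq hb hx (by decide)) (h.adj_of_eq hb hy (by decide))
    (h.adj_of_eq hb hu (by decide)) hx.2 hy.2 hu.2 (by decide)
  have Hu := adj_iff_of_three_values (q := q) (f := 0) (k := 4) hG (v := u) (x := a) (y := b)
    (z := c) (h.adj_of_eq hu ha (by decide)) (h.adj_of_eq hu hb (by decide))
    ((h.adj_iff _ _).2 (Or.inl ⟨by rw [hu.1]; clear * - hcp; omega, by rw [hu.2, hcq]; simp⟩))
    ha.2 hb.2 hcq (by decide)
  exact ⟨l, (.clique, x, y) :: (.indep, a, b) :: (.single, u, u) :: L, hl, by rw [hn],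
    by simp [hL, chainWord], isLayering_start Hx Hy Ha Hb Hu hh hLay⟩

lemma exists_layering [Finite V] {G : SimpleGraph V} {n : ℕ} {p q : V → ℕ}
    (hc : G.Connected) (hG : ∀ v, (G.neighborSet v).ncard = 3) (h : IsRealizer G n p q)
    (hn : 6 < n) :
    ∃ (l : List ℕ) (L : List (Layer × V × V)), (∀ x ∈ l, x = 2 ∨ x = 3) ∧
      n = 10 + 2 * l.sum ∧ L.map Prod.fst = chainWord l ∧ IsLayering G [] L := by
  have U : UsedAt p q n 0 0 ∅ := by simp [UsedAt]
  obtain ⟨v₀, hp₀, hq₀, U⟩ := h.exists_next_eq hG U (by omega) (e := 3) (by decide +kernel)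
  rcases h.exists_next_pair hG U (h.lt_of_gap U (by decide)) (e₁ := 2) (e₂ := 4)
    (by decide +kernel) with ⟨v₁, hp₁, hq₁, U⟩ | ⟨v₁, hp₁, hq₁, U⟩
  · rcases h.exists_next_pair hG U (h.lt_of_gap U (by decide)) (e₁ := 1) (e₂ := 5)
      (by decide +kernel) with ⟨v₂, hp₂, hq₂, U⟩ | ⟨v₂, hp₂, hq₂, U⟩
    · obtain ⟨v₃, hp₃, hq₃, U⟩ := h.exists_next_eq hG U (h.lt_of_gap U (by decide))
        (e := 0) (by decide +kernel)
      have := h.le_of_lower (k := 4) hc (by simp) fun v => by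
        have h1 := U.1 v
        simp only [Finset.mem_insert, exists_eq_or_imp, exists_eq_left, Finset.notMem_empty,
          or_false] at h1
        clear * - h1
        omega
      omega
    · obtain ⟨v₃, hp₃, hq₃, U⟩ := h.exists_next_eq hG U (h.lt_of_gap U (by decide))
        (e := 0) (by decide +kernel)
      obtain ⟨v₄, hp₄, hq₄, U⟩ := h.exists_next_eq hG U (h.lt_of_gap U (by decide))
        (e := 1) (by decide +kernel)
      refine exists_layering_of_start hc hG h ⟨fun v => ?_, ?_⟩ (x := v₀) (y := v₁) (u := v₂)
        (a := v₃) (b := v₄) ⟨hp₀, hq₀⟩ ⟨hp₁, hq₁⟩ ⟨hp₂, hq₂⟩ ⟨hp₃, hq₃⟩ ⟨hp₄, hq₄⟩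
      · have h1 := U.1 v
        simp only [Finset.mem_insert, Finset.mem_singleton, exists_eq_or_imp, exists_eq_left,
          Finset.notMem_empty, or_false] at h1 ⊢
        clear * - h1
        omega
      · simpa using U.2 5 (by decide)
  · rcases h.exists_next_pair hG U (h.lt_of_gap U (by decide)) (e₁ := 1) (e₂ := 5)
      (by decide +kernel) with ⟨v₂, hp₂, hq₂, U⟩ | ⟨v₂, hp₂, hq₂, U⟩
    · obtain ⟨v₃, hp₃, hq₃, U⟩ := h.exists_next_eq hG U (h.lt_of_gap U (by decide))
        (e := 0) (by decide +kernel)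
      obtain ⟨v₄, hp₄, hq₄, U⟩ := h.exists_next_eq hG U (h.lt_of_gap U (by decide))
        (e := 7) (by decide +kernel)
      obtain ⟨v₅, hp₅, hq₅, U⟩ := h.exists_next_eq hG U (h.lt_of_gap U (by decide))
        (e := 2) (by decide +kernel)
      have U' : UsedAt p q n (0 + 6) 0 {2, 7, 0, 3, 4, 1} := by
        convert U using 1
        decide
      exact exists_layering_of_start hc hG h.swap (U'.after_diamond (fun v => by
        rw [← hp₄, ← hq₄]; exact h.p_inj.eq_iff.trans h.q_inj.eq_iff.symm) (hp₅ ▸ h.p_lt v₅))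
        (x := v₃) (y := v₂) (u := v₅) (a := v₀) (b := v₁)
        ⟨hq₃, hp₃⟩ ⟨hq₂, hp₂⟩ ⟨hq₅, hp₅⟩ ⟨hq₀, hp₀⟩ ⟨hq₁, hp₁⟩
    · obtain ⟨v₃, hp₃, hq₃, U⟩ := h.exists_next_eq hG U (h.lt_of_gap U (by decide))
        (e := 0) (by decide +kernel)
      obtain ⟨v₄, hp₄, hq₄, U⟩ := h.exists_next_eq hG U (h.lt_of_gap U (by decide))
        (e := 1) (by decide +kernel)
      obtain ⟨v₅, hp₅, hq₅, U⟩ := h.exists_next_eq hG U (h.lt_of_gap U (by decide))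
        (e := 2) (by decide +kernel)
      have := h.le_of_lower (k := 6) hc (by simp) fun v => by
        have h1 := U.1 v
        simp only [Finset.mem_insert, exists_eq_or_imp, exists_eq_left, Finset.notMem_empty,
          or_false] at h1
        clear * - h1
        omega
      omega

/-- The vertices of the layer with index `i`. -/
def vertsAt (L : List (Layer × V × V)) (i : ℕ) : List V :=
  match L[i]? with
  | some (_, x, y) => [x, y]
  | none => []

lemma vertsAt_succ (a : Layer × V × V) (L : List (Layer × V × V)) (i : ℕ) :
    vertsAt (a :: L) (i + 1) = vertsAt L i := by
  simp [vertsAt]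

lemma vertsAt_zero (L : List (Layer × V × V)) : vertsAt L 0 = headVerts L := by
  cases L <;> rfl

lemma IsLayering.adj_iff {G : SimpleGraph V} {L : List (Layer × V × V)} :
    ∀ {prev : List V}, IsLayering G prev L → ∀ {i : ℕ} {s x y}, L[i]? = some (s, x, y) →
      (∀ v, G.Adj x v ↔ ((i = 0 ∧ v ∈ prev) ∨ ∃ j, j + 1 = i ∧ v ∈ vertsAt L j) ∨
        v ∈ vertsAt L (i + 1) ∨ (s = .clique ∧ v = y)) ∧
      (∀ v, G.Adj y v ↔ ((i = 0 ∧ v ∈ prev) ∨ ∃ j, j + 1 = i ∧ v ∈ vertsAt L j) ∨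
        v ∈ vertsAt L (i + 1) ∨ (s = .clique ∧ v = x)) ∧
      (s = .single → x = y) := by
  induction L with
  | nil => simp
  | cons a r ih =>
    obtain ⟨s', x', y'⟩ := a
    intro prev hL i s x y hi
    rw [isLayering_cons] at hL
    obtain ⟨h1, h2, h3, h4⟩ := hL
    cases i with
    | zero =>
      simp only [List.getElem?_cons_zero, Option.some.injEq, Prod.mk.injEq] at hi
      obtain ⟨rfl, rfl, rfl⟩ := hi
      simp only [h1, h2, vertsAt_succ, vertsAt_zero]
      simpa using h3
    | succ i =>
      rw [List.getElem?_cons_succ] at hi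
      obtain ⟨k1, k2, k3⟩ := ih h4 hi
      have key : ∀ v, ((i = 0 ∧ v ∈ [x', y']) ∨ ∃ j, j + 1 = i ∧ v ∈ vertsAt r j) ↔
          ((i + 1 = 0 ∧ v ∈ prev) ∨ ∃ j, j + 1 = i + 1 ∧ v ∈ vertsAt ((s', x', y') :: r) j) := by
        intro v
        cases i with
        | zero => simp [vertsAt]
        | succ i => simp [vertsAt_succ]
      refine ⟨fun v => ?_, fun v => ?_, k3⟩
      · rw [k1, key, vertsAt_succ]
      · rw [k2, key, vertsAt_succ]

end Layering

/-- The vertices of the layered graph of `W`: a layer index and a Boolean, which is `false` in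
one-vertex layers. -/
@[ext]
structure LVert (W : List Layer) where
  /-- The index of the layer. -/
  idx : ℕ
  /-- The side inside the layer. -/
  side : Bool
  exists_layer : ∃ s, W[idx]? = some s ∧ (s = .single → side = false)

/-- The graph with layers `W`, consecutive layers being completely joined. -/
def layerGraph (W : List Layer) : SimpleGraph (LVert W) where
  Adj u v := u.idx + 1 = v.idx ∨ v.idx + 1 = u.idx ∨
    (u.idx = v.idx ∧ u.side ≠ v.side ∧ W[u.idx]? = some .clique)
  symm := ⟨fun u v h => by
    rcases h with h | h | ⟨h1, h2, h3⟩
    · exact Or.inr (Or.inl h)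
    · exact Or.inl h
    · exact Or.inr (Or.inr ⟨h1.symm, h2.symm, h1 ▸ h3⟩)⟩
  loopless := ⟨fun u h => by rcases h with h | h | h <;> simp at h⟩

lemma layerGraph_adj {W : List Layer} {u v : LVert W} : (layerGraph W).Adj u v ↔
    u.idx + 1 = v.idx ∨ v.idx + 1 = u.idx ∨
      (u.idx = v.idx ∧ u.side ≠ v.side ∧ W[u.idx]? = some .clique) := Iff.rfl

lemma LVert.lt_length {W : List Layer} (u : LVert W) : u.idx < W.length := by
  obtain ⟨s, h, _⟩ := u.exists_layer
  exact (List.getElem?_eq_some_iff.1 h).1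

instance (W : List Layer) : Finite (LVert W) :=
  Finite.of_injective (β := Fin W.length × Bool) (fun u => (⟨u.idx, u.lt_length⟩, u.side))
    fun u v h => by
      simp only [Prod.mk.injEq, Fin.mk.injEq] at h
      exact LVert.ext h.1 h.2

lemma IsLayering.nonempty_iso {V : Type*} [Finite V] {G : SimpleGraph V}
    {L : List (Layer × V × V)} (hL : IsLayering G [] L) {W : List Layer}
    (hW : L.map Prod.fst = W) (hne : Nonempty (LVert W)) (hc : G.Connected)
    (hcard : Nat.card (LVert W) = Nat.card V) : Nonempty (layerGraph W ≃g G) := by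
  have hlen : ∀ u : LVert W, u.idx < L.length := fun u => by
    have h1 := u.lt_length
    have h2 : L.length = W.length := by rw [← hW, List.length_map]
    omega
  let f : LVert W → V := fun u => bif u.side then (L[u.idx]'(hlen u)).2.2 else (L[u.idx]'(hlen u)).2.1
  have hWi : ∀ {i : ℕ} {s : Layer} {x y : V}, L[i]? = some (s, x, y) → W[i]? = some s := by
    intro i s x y h
    rw [← hW, List.getElem?_map, h]; rfl
  have hf : ∀ {i : ℕ} {s : Layer} {x y : V}, L[i]? = some (s, x, y) → ∀ u : LVert W, u.idx = i →
      f u = bif u.side then y else x := by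
    rintro i s x y h u rfl
    obtain ⟨h1, h2⟩ := List.getElem?_eq_some_iff.1 h
    simp only [f, h2]
  have hmem : ∀ i v, v ∈ vertsAt L i ↔ ∃ w : LVert W, w.idx = i ∧ f w = v := by
    intro i v
    rcases h : L[i]? with _ | ⟨s, x, y⟩
    · have : ∀ w : LVert W, w.idx ≠ i := by
        rintro w rfl
        have := List.getElem?_eq_none_iff.1 h
        have := hlen w
        omega
      simp [vertsAt, h, this]
    · have hxy := (hL.adj_iff h).2.2
      simp only [vertsAt, h, List.mem_cons, List.not_mem_nil, or_false]
      constructor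
      · intro hv
        by_cases hs : s = .single
        · refine ⟨⟨i, false, s, hWi h, fun _ => rfl⟩, rfl, ?_⟩
          rw [hf h _ rfl]
          rcases hv with rfl | rfl
          · rfl
          · exact hxy hs
        · rcases hv with rfl | rfl
          · exact ⟨⟨i, false, s, hWi h, fun _ => rfl⟩, rfl, hf h _ rfl⟩
          · exact ⟨⟨i, true, s, hWi h, fun h => absurd h hs⟩, rfl, hf h _ rfl⟩
      · rintro ⟨w, hw, rfl⟩
        rw [hf h w hw]
        cases w.side <;> simp
  have hadj : ∀ u v, G.Adj (f u) v ↔ ∃ w, (layerGraph W).Adj u w ∧ f w = v := by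
    intro u v
    rcases h : L[u.idx]? with _ | ⟨s, x, y⟩
    · have := List.getElem?_eq_none_iff.1 h
      have := hlen u
      omega
    · obtain ⟨h1, h2, h3⟩ := hL.adj_iff h
      have hs : W[u.idx]? = some s := hWi h
      have key : G.Adj (f u) v ↔ (∃ j, j + 1 = u.idx ∧ v ∈ vertsAt L j) ∨
          v ∈ vertsAt L (u.idx + 1) ∨ (s = .clique ∧ v = bif u.side then x else y) := by
        rw [hf h u rfl]
        cases u.side <;> simp [h1, h2]
      rw [key]
      simp only [hmem, layerGraph_adj]
      constructor
      · rintro (⟨_, hj, w, rfl, rfl⟩ | ⟨w, hw, rfl⟩ | ⟨rfl, rfl⟩)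
        · exact ⟨w, Or.inr (Or.inl hj), rfl⟩
        · exact ⟨w, Or.inl hw.symm, rfl⟩
        · have hw : ∃ s, W[u.idx]? = some s ∧ (s = .single → (!u.side) = false) :=
            ⟨_, hs, fun h => by cases h⟩
          refine ⟨⟨u.idx, !u.side, hw⟩, Or.inr (Or.inr ⟨rfl, by simp, hs⟩), ?_⟩
          rw [hf h ⟨u.idx, !u.side, hw⟩ rfl]
          simp only [Bool.cond_not]
      · rintro ⟨w, hw | hw | ⟨hw, hb, hcl⟩, rfl⟩
        · exact Or.inr (Or.inl ⟨w, hw.symm, rfl⟩)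
        · exact Or.inl ⟨_, hw, w, rfl, rfl⟩
        · refine Or.inr (Or.inr ⟨Option.some_injective _ (hs.symm.trans hcl), ?_⟩)
          rw [hf h w hw.symm]
          revert hb
          cases u.side <;> cases w.side <;> simp
  have hsurj : Function.Surjective f := by
    obtain ⟨u₀⟩ := hne
    have key : ∀ a b, G.Walk a b → a ∈ Set.range f → b ∈ Set.range f := by
      intro a b w
      induction w with
      | nil => exact id
      | cons hab w ih =>
        rintro ⟨u, rfl⟩
        obtain ⟨w, _, hw⟩ := (hadj _ _).1 hab
        exact ih ⟨w, hw⟩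
    intro v
    obtain ⟨w⟩ := hc.preconnected (f u₀) v
    exact key _ _ w ⟨u₀, rfl⟩
  have hbij : Function.Bijective f :=
    (Nat.bijective_iff_surjective_and_card f).2 ⟨hsurj, hcard⟩
  refine ⟨⟨Equiv.ofBijective f hbij, fun {a b} => ?_⟩⟩
  rw [Equiv.ofBijective_apply, Equiv.ofBijective_apply, hadj]
  constructor
  · rintro ⟨w, hw, h⟩
    rwa [← hbij.1 h]
  · exact fun h => ⟨b, h, rfl⟩

/-- The number of vertices of a layer. -/
def Layer.size : Layer → ℕ
  | .single => 1
  | .indep => 2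
  | .clique => 2

/-- The number of vertices of the layer with index `i`. -/
def sizeAt (W : List Layer) (i : ℕ) : ℕ := (W[i]?).elim 0 Layer.size

lemma Layer.one_le_size (s : Layer) : 1 ≤ s.size := by cases s <;> simp [size]

section LayerGraph

variable {W W' : List Layer}

lemma ncard_idx_eq (W : List Layer) (i : ℕ) : {u : LVert W | u.idx = i}.ncard = sizeAt W i := by
  rcases h : W[i]? with _ | s
  · have : {u : LVert W | u.idx = i} = ∅ := by
      rw [Set.eq_empty_iff_forall_notMem]
      rintro ⟨j, b, s, hs, _⟩ rfl
      simp [h] at hs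
    rw [this, Set.ncard_empty, sizeAt, h]; rfl
  · by_cases hs : s = .single
    · have : {u : LVert W | u.idx = i} = {⟨i, false, s, h, fun _ => rfl⟩} := by
        ext ⟨j, b, t, ht, hb⟩
        simp only [Set.mem_ofPred_eq, Set.mem_singleton_iff, LVert.mk.injEq]
        refine ⟨?_, fun h => h.1⟩
        rintro rfl
        obtain rfl : s = t := Option.some_injective _ (h.symm.trans ht)
        exact ⟨rfl, hb hs⟩
      rw [this, Set.ncard_singleton, sizeAt, h, hs]; rfl
    · have : {u : LVert W | u.idx = i} = {⟨i, false, s, h, fun _ => rfl⟩,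
          ⟨i, true, s, h, fun h => absurd h hs⟩} := by
        ext ⟨j, b, t, ht, hb⟩
        simp only [Set.mem_ofPred_eq, Set.mem_singleton_iff, Set.mem_insert_iff, LVert.mk.injEq]
        cases b <;> simp
      rw [this, Set.ncard_pair (by simp), sizeAt, h]
      cases s
      exacts [absurd rfl hs, rfl, rfl]

lemma sum_range_sizeAt (W : List Layer) :
    ∑ i ∈ Finset.range W.length, sizeAt W i = (W.map Layer.size).sum := by
  induction W with
  | nil => rfl
  | cons s W ih =>
    rw [List.length_cons, Finset.sum_range_succ', List.map_cons, List.sum_cons, ← ih, add_comm]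
    simp [sizeAt]

lemma card_lvert (W : List Layer) : Nat.card (LVert W) = (W.map Layer.size).sum := by
  classical
  have := Fintype.ofFinite (LVert W)
  rw [← sum_range_sizeAt, Nat.card_eq_fintype_card, ← Finset.card_univ,
    Finset.card_eq_sum_card_fiberwise (f := LVert.idx) (t := Finset.range W.length)
      fun u _ => by simpa using u.lt_length]
  refine Finset.sum_congr rfl fun i _ => ?_
  rw [← ncard_idx_eq, ← Set.ncard_coe_finset]
  simp

lemma sum_size_tailWord {l : List ℕ} (hl : ∀ x ∈ l, x = 2 ∨ x = 3) :
    ((tailWord l).map Layer.size).sum = 5 + 2 * l.sum := by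
  induction l with
  | nil => rfl
  | cons x l ih =>
    have := ih fun y hy => hl y (by simp [hy])
    rcases hl x (by simp) with rfl | rfl
    · simp [tailWord_two, Layer.size, this]; omega
    · simp [tailWord_three, Layer.size, this]; omega

lemma card_lvert_chainWord {l : List ℕ} (hl : ∀ x ∈ l, x = 2 ∨ x = 3) :
    Nat.card (LVert (chainWord l)) = 10 + 2 * l.sum := by
  rw [card_lvert, chainWord, List.map_append, List.sum_append, sum_size_tailWord hl]
  simp [Layer.size]
  omega

/-- Every vertex of the layers, preceded by a layer with `a` vertices, has degree `3`. -/
def DegreesThree : ℕ → List Layer → Prop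
  | _, [] => True
  | a, s :: W => a + sizeAt W 0 + (if s = .clique then 1 else 0) = 3 ∧ DegreesThree s.size W

lemma degreesThree_tailWord {l : List ℕ} (hl : ∀ x ∈ l, x = 2 ∨ x = 3) :
    DegreesThree 1 (tailWord l) ∧ sizeAt (tailWord l) 0 = 1 := by
  induction l with
  | nil => simp [tailWord, DegreesThree, Layer.size, sizeAt]
  | cons x l ih =>
    have := ih fun y hy => hl y (by simp [hy])
    rcases hl x (by simp) with rfl | rfl
    · rw [tailWord_two]
      simp [DegreesThree, Layer.size, this]
      simp [sizeAt, Layer.size]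
    · rw [tailWord_three]
      simp [DegreesThree, Layer.size, this]
      simp [sizeAt, Layer.size]

lemma degreesThree_chainWord {l : List ℕ} (hl : ∀ x ∈ l, x = 2 ∨ x = 3) :
    DegreesThree 0 (chainWord l) := by
  have h := degreesThree_tailWord hl
  simp [DegreesThree, Layer.size, h, chainWord]
  simp [sizeAt, Layer.size]

lemma DegreesThree.eq {W : List Layer} : ∀ {a : ℕ}, DegreesThree a W → ∀ {i s}, W[i]? = some s →
    (if i = 0 then a else sizeAt W (i - 1)) + sizeAt W (i + 1) +
      (if s = .clique then 1 else 0) = 3 := by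
  induction W with
  | nil => simp
  | cons t W ih =>
    rintro a ⟨h1, h2⟩ i s hi
    cases i with
    | zero =>
      obtain rfl : t = s := by simpa using hi
      simpa [sizeAt] using h1
    | succ i =>
      have := ih h2 (i := i) (s := s) (by simpa using hi)
      rcases i with _ | i
      · simpa [sizeAt] using this
      · simpa [sizeAt] using this

lemma ncard_neighborSet (v : LVert W) {s : Layer} (hs : W[v.idx]? = some s) :
    ((layerGraph W).neighborSet v).ncard =
      (if v.idx = 0 then 0 else sizeAt W (v.idx - 1)) + sizeAt W (v.idx + 1) +
        (if s = .clique then 1 else 0) := by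
  have h1 : (layerGraph W).neighborSet v = {u : LVert W | u.idx + 1 = v.idx} ∪
      {u | u.idx = v.idx + 1} ∪ {u | u.idx = v.idx ∧ u.side ≠ v.side ∧ s = .clique} := by
    ext u
    simp only [SimpleGraph.mem_neighborSet, layerGraph_adj, hs, Option.some.injEq, Set.mem_union,
      Set.mem_ofPred_eq]
    rw [eq_comm (a := v.idx + 1), eq_comm (a := v.idx) (b := u.idx), ne_comm (a := v.side)]
    tauto
  have h2 : {u : LVert W | u.idx + 1 = v.idx}.ncard =
      if v.idx = 0 then 0 else sizeAt W (v.idx - 1) := by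
    split_ifs with h
    · simp [h]
    · rw [← ncard_idx_eq]
      congr 1
      ext u
      simp only [Set.mem_ofPred_eq]
      omega
  have h3 : {u : LVert W | u.idx = v.idx ∧ u.side ≠ v.side ∧ s = .clique}.ncard =
      if s = .clique then 1 else 0 := by
    split_ifs with h
    · have hw : ∃ s, W[v.idx]? = some s ∧ (s = .single → (!v.side) = false) :=
        ⟨s, hs, fun h' => by rw [h] at h'; cases h'⟩
      rw [Set.ncard_eq_one]
      refine ⟨⟨v.idx, !v.side, hw⟩, ?_⟩
      ext u
      simp only [Set.mem_ofPred_eq, Set.mem_singleton_iff, LVert.ext_iff, h]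
      cases u.side <;> cases v.side <;> simp
    · simp [h]
  rw [h1, Set.ncard_union_eq, Set.ncard_union_eq, h2, h3, ncard_idx_eq]
  · rw [Set.disjoint_left]
    intro u h1 h2
    simp only [Set.mem_ofPred_eq] at h1 h2
    omega
  · rw [Set.disjoint_left]
    intro u h1 h2
    simp only [Set.mem_union, Set.mem_ofPred_eq] at h1 h2
    omega

lemma isRegular_chainWord {l : List ℕ} (hl : ∀ x ∈ l, x = 2 ∨ x = 3) :
    IsRegular' (layerGraph (chainWord l)) 3 := by
  intro v
  obtain ⟨s, hs, -⟩ := v.exists_layer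
  rw [ncard_neighborSet v hs, (degreesThree_chainWord hl).eq hs]

lemma exists_lvert {i : ℕ} (hi : i < W.length) : ∃ u : LVert W, u.idx = i :=
  ⟨⟨i, false, W[i], List.getElem?_eq_getElem hi, fun _ => rfl⟩, rfl⟩

lemma layerGraph_connected (hW : 2 ≤ W.length) : (layerGraph W).Connected := by
  obtain ⟨r, hr⟩ := exists_lvert (W := W) (i := 0) (by omega)
  have key : ∀ i, ∀ u : LVert W, u.idx = i → (layerGraph W).Reachable r u := by
    intro i
    induction i with
    | zero =>
      intro u hu
      obtain ⟨w, hw⟩ := exists_lvert (W := W) (i := 1) (by omega)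
      have h1 : (layerGraph W).Adj r w := Or.inl (by omega)
      have h2 : (layerGraph W).Adj w u := Or.inr (Or.inl (by omega))
      exact h1.reachable.trans h2.reachable
    | succ i ih =>
      intro u hu
      obtain ⟨w, hw⟩ := exists_lvert (W := W) (i := i) (by have := u.lt_length; omega)
      have h : (layerGraph W).Adj w u := Or.inl (by omega)
      exact (ih w hw).trans h.reachable
  have : Nonempty (LVert W) := ⟨r⟩
  exact ⟨fun u v => (key _ u rfl).symm.trans (key _ v rfl)⟩

lemma six_le_length_chainWord (l : List ℕ) : 6 ≤ (chainWord l).length := by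
  simp [chainWord, tailWord]

end LayerGraph

lemma exists_equiv_fin_lt_iff {V : Type*} [Fintype V] (k : V → ℕ) (hk : Function.Injective k) :
    ∃ e : V ≃ Fin (Fintype.card V), ∀ u v, e u < e v ↔ k u < k v := by
  classical
  let _ : LinearOrder V := LinearOrder.lift' k hk
  let e := Fintype.orderIsoFinOfCardEq V rfl
  exact ⟨e.symm.toEquiv, fun u v => e.symm.lt_iff_lt⟩

lemma isPermGraph_of_keys {V : Type*} [Finite V] {G : SimpleGraph V} (k₁ k₂ : V → ℕ)
    (h₁ : Function.Injective k₁) (h₂ : Function.Injective k₂)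
    (h : ∀ u v, G.Adj u v ↔ (k₁ u < k₁ v ∧ k₂ v < k₂ u) ∨ (k₁ v < k₁ u ∧ k₂ u < k₂ v)) :
    IsPermGraph G := by
  have := Fintype.ofFinite V
  obtain ⟨e₁, he₁⟩ := exists_equiv_fin_lt_iff k₁ h₁
  obtain ⟨e₂, he₂⟩ := exists_equiv_fin_lt_iff k₂ h₂
  refine ⟨_, e₁.symm.trans e₂, ⟨⟨e₁, fun {u v} => ?_⟩⟩⟩
  rw [graphOfPerm, SimpleGraph.fromRel_adj, h]
  simp only [Equiv.trans_apply, Equiv.symm_apply_apply, he₁, he₂]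
  refine ⟨fun h => h.2, fun h => ⟨fun h' => ?_, h⟩⟩
  rw [e₁.injective h'] at h
  omega

lemma isPermGraph_layerGraph (W : List Layer) : IsPermGraph (layerGraph W) := by
  let c : LVert W → ℕ := fun u => if u.side then 1 else 0
  let d : LVert W → ℕ := fun u => if W[u.idx]? = some .clique then 1 - c u else c u
  have hc : ∀ u, c u ≤ 1 := fun u => by simp only [c]; split_ifs <;> omega
  have hcc : ∀ u v, c u = c v ↔ u.side = v.side := fun u v => by
    simp only [c]; cases u.side <;> cases v.side <;> simp
  have hd : ∀ u, (W[u.idx]? = some .clique ∧ d u + c u = 1) ∨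
      (W[u.idx]? ≠ some .clique ∧ d u = c u) := fun u => by
    have := hc u
    simp only [d]
    split_ifs with h
    · simp [h]; omega
    · simp [h]
  refine isPermGraph_of_keys
    (fun u => 2 * (if u.idx % 2 = 0 then 2 * u.idx else 2 * u.idx + 3) + c u)
    (fun u => 2 * (if u.idx % 2 = 0 then 2 * u.idx + 3 else 2 * u.idx) + d u) ?_ ?_ ?_
  · intro u v h
    have h1 := hc u
    have h2 := hc v
    have h3 : u.idx = v.idx := by simp only at h; split_ifs at h <;> omega
    refine LVert.ext h3 ((hcc u v).1 ?_)
    simp only [h3] at h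
    omega
  · intro u v h
    have h1 := hc u
    have h2 := hc v
    have h1 := hd u
    have h2 := hd v
    have h3 : u.idx = v.idx := by simp only at h; split_ifs at h <;> omega
    refine LVert.ext h3 ((hcc u v).1 ?_)
    simp only [h3] at h h1
    by_cases h4 : W[v.idx]? = some .clique
    · simp [h4] at h1 h2
      omega
    · simp [h4] at h1 h2
      omega
  · intro u v
    have h1 := hc u
    have h2 := hc v
    have h3 := hd u
    have h4 := hd v
    have h5 := hcc u v
    rw [layerGraph_adj, ne_eq, ← h5]
    by_cases h6 : u.idx = v.idx
    · simp only [h6] at h3 ⊢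
      by_cases h7 : W[v.idx]? = some .clique
      · replace h3 : d u + c u = 1 := by simpa [h7] using h3
        replace h4 : d v + c v = 1 := by simpa [h7] using h4
        simp only [h7, and_true, true_and]
        clear hc hcc hd
        split_ifs <;> omega
      · replace h3 : d u = c u := by simpa [h7] using h3
        replace h4 : d v = c v := by simpa [h7] using h4
        simp only [h7, and_false, or_false]
        clear hc hcc hd
        split_ifs <;> omega
    · simp only [h6, false_and, or_false]
      clear hc hcc hd
      split_ifs <;> omega

lemma chainWord_reverse (l : List ℕ) : (chainWord l).reverse = chainWord l.reverse := by
  have h : List.reverse ∘ blockWord = blockWord := by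
    funext x
    simp only [Function.comp, blockWord]
    split_ifs <;> rfl
  simp [chainWord, tailWord, List.reverse_flatMap, h]

section Uniqueness

variable {W W' : List Layer}

/-- Reading the layers in the opposite order. -/
def LVert.flip (h : W' = W.reverse) (u : LVert W) : LVert W' where
  idx := W.length - 1 - u.idx
  side := u.side
  exists_layer := by
    obtain ⟨s, hs, hs'⟩ := u.exists_layer
    have := u.lt_length
    refine ⟨s, ?_, hs'⟩
    rw [h, List.getElem?_reverse (by omega), ← hs]
    congr 1
    omega

lemma LVert.flip_flip (h : W' = W.reverse) (h' : W = W'.reverse) (u : LVert W) :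
    (u.flip h).flip h' = u := by
  have := u.lt_length
  refine LVert.ext ?_ rfl
  simp only [LVert.flip, h, List.length_reverse]
  omega

/-- Reading the layers in the opposite order gives an isomorphic graph. -/
def layerGraphFlip (h : W' = W.reverse) : layerGraph W ≃g layerGraph W' where
  toFun := LVert.flip h
  invFun := LVert.flip (by simp [h])
  left_inv u := u.flip_flip _ _
  right_inv u := u.flip_flip _ _
  map_rel_iff' := by
    intro u v
    have hu := u.lt_length
    have hv := v.lt_length
    have h1 : W'[(u.flip h).idx]? = W[u.idx]? := by
      simp only [LVert.flip]
      rw [h, List.getElem?_reverse (by omega)]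
      congr 1
      omega
    simp only [Equiv.coe_fn_mk, layerGraph_adj, h1]
    simp only [LVert.flip]
    rw [show W.length - 1 - u.idx + 1 = W.length - 1 - v.idx ↔ v.idx + 1 = u.idx by omega,
      show W.length - 1 - v.idx + 1 = W.length - 1 - u.idx ↔ u.idx + 1 = v.idx by omega,
      show W.length - 1 - u.idx = W.length - 1 - v.idx ↔ u.idx = v.idx by omega]
    tauto

lemma layerGraphFlip_idx (h : W' = W.reverse) (u : LVert W) :
    (layerGraphFlip h u).idx = W.length - 1 - u.idx := rfl

/-- The vertex `v` has a twin `w` such that two further neighbours of `v` have a common neighbour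
besides `v` and `w`. -/
def IsEndVertex {V : Type*} (G : SimpleGraph V) (v : V) : Prop :=
  ∃ w, G.Adj v w ∧ (∀ z, G.Adj v z → z = w ∨ G.Adj z w) ∧
    ∃ x y u, x ≠ y ∧ x ≠ w ∧ y ≠ w ∧ G.Adj v x ∧ G.Adj v y ∧ u ≠ v ∧ u ≠ w ∧
      G.Adj x u ∧ G.Adj y u

lemma IsEndVertex.map {V V' : Type*} {G : SimpleGraph V} {G' : SimpleGraph V'} (φ : G ≃g G')
    {v : V} (h : IsEndVertex G v) : IsEndVertex G' (φ v) := by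
  obtain ⟨w, hw, hz, x, y, u, h1, h2, h3, h4, h5, h6, h7, h8, h9⟩ := h
  refine ⟨φ w, φ.map_adj_iff.2 hw, fun z hvz => ?_, φ x, φ y, φ u, φ.injective.ne h1,
    φ.injective.ne h2, φ.injective.ne h3, φ.map_adj_iff.2 h4, φ.map_adj_iff.2 h5,
    φ.injective.ne h6, φ.injective.ne h7, φ.map_adj_iff.2 h8, φ.map_adj_iff.2 h9⟩
  obtain ⟨z, rfl⟩ := φ.surjective z
  rw [φ.map_adj_iff, φ.injective.eq_iff]
  exact hz z (φ.map_adj_iff.1 hvz)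

lemma one_le_sizeAt {i : ℕ} (hi : i < W.length) : 1 ≤ sizeAt W i := by
  rw [sizeAt, List.getElem?_eq_getElem hi]
  exact Layer.one_le_size _

lemma LVert.eq_of_sizeAt {i : ℕ} (h : sizeAt W i = 1) {u v : LVert W} (hu : u.idx = i)
    (hv : v.idx = i) : u = v := by
  rw [← ncard_idx_eq, Set.ncard_eq_one] at h
  obtain ⟨a, ha⟩ := h
  have h1 : u ∈ ({a} : Set (LVert W)) := ha ▸ hu
  have h2 : v ∈ ({a} : Set (LVert W)) := ha ▸ hv
  exact h1.trans h2.symm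

lemma LVert.eq_or_eq {u v w : LVert W} (h1 : u.idx = v.idx) (h2 : v.idx = w.idx)
    (h3 : v.side ≠ w.side) : u = v ∨ u = w := by
  by_cases h : u.side = v.side
  · exact Or.inl (LVert.ext h1 h)
  · refine Or.inr (LVert.ext (h1.trans h2) ?_)
    revert h h3
    cases u.side <;> cases v.side <;> cases w.side <;> simp

lemma IsEndVertex.idx_eq (hW : DegreesThree 0 W) {v : LVert W}
    (h : IsEndVertex (layerGraph W) v) : v.idx = 0 ∨ v.idx + 1 = W.length := by
  obtain ⟨w, hw, hz, x, y, u, hxy, hxw, hyw, hvx, hvy, huv, huw, hxu, hyu⟩ := h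
  by_contra! hv
  have hlt := v.lt_length
  obtain ⟨p, hp⟩ := exists_lvert (W := W) (i := v.idx - 1) (by omega)
  obtain ⟨q, hq⟩ := exists_lvert (W := W) (i := v.idx + 1) (by omega)
  rcases layerGraph_adj.1 hw with h | h | ⟨h1, h2, h3⟩
  · rcases hz p (Or.inr (Or.inl (by omega))) with rfl | h'
    · omega
    · rcases layerGraph_adj.1 h' with h' | h' | ⟨h', -⟩ <;> omega
  · rcases hz q (Or.inl (by omega)) with rfl | h'
    · omega
    · rcases layerGraph_adj.1 h' with h' | h' | ⟨h', -⟩ <;> omega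
  · have hd := hW.eq h3
    rw [if_neg hv.1, if_pos rfl] at hd
    have s1 := one_le_sizeAt (W := W) (i := v.idx - 1) (by omega)
    have s2 := one_le_sizeAt (W := W) (i := v.idx + 1) (by omega)
    have key : ∀ z, (layerGraph W).Adj v z → z ≠ w → z.idx + 1 = v.idx ∨ z.idx = v.idx + 1 := by
      intro z hvz hzw
      rcases layerGraph_adj.1 hvz with h | h | ⟨h, h', -⟩
      · exact Or.inr h.symm
      · exact Or.inl h
      · rcases LVert.eq_or_eq (u := z) h.symm h1 h2 with rfl | rfl
        · exact absurd rfl h'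
        · exact absurd rfl hzw
    have hu : u.idx ≠ v.idx := fun h => by
      rcases LVert.eq_or_eq h h1 h2 with h | h
      · exact huv h
      · exact huw h
    have kx := key x hvx hxw
    have ky := key y hvy hyw
    have hne : x.idx ≠ y.idx := fun h => by
      rcases kx with k | k
      · exact hxy (LVert.eq_of_sizeAt (i := v.idx - 1) (by omega) (by omega) (by omega))
      · exact hxy (LVert.eq_of_sizeAt (i := v.idx + 1) (by omega) (by omega) (by omega))
    have ax : x.idx ≤ u.idx + 1 ∧ u.idx ≤ x.idx + 1 := by
      rcases layerGraph_adj.1 hxu with h | h | ⟨h, -⟩ <;> omega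
    have ay : y.idx ≤ u.idx + 1 ∧ u.idx ≤ y.idx + 1 := by
      rcases layerGraph_adj.1 hyu with h | h | ⟨h, -⟩ <;> omega
    omega

lemma isEndVertex_chainWord {l : List ℕ} {v : LVert (chainWord l)} (hv : v.idx = 0) :
    IsEndVertex (layerGraph (chainWord l)) v := by
  let w : LVert (chainWord l) := ⟨0, !v.side, .clique, rfl, by simp⟩
  let x : LVert (chainWord l) := ⟨1, false, .indep, rfl, by simp⟩
  let y : LVert (chainWord l) := ⟨1, true, .indep, rfl, by simp⟩
  let u : LVert (chainWord l) := ⟨2, false, .single, rfl, by simp⟩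
  have hc : (chainWord l)[v.idx]? = some .clique := by rw [hv]; rfl
  have hvw : v.side ≠ w.side := by simp [w]
  have hi : v.idx = w.idx := hv
  refine ⟨w, Or.inr (Or.inr ⟨hi, hvw, hc⟩), fun z hz => ?_, x, y, u, ?_, ?_, ?_,
    Or.inl ?_, Or.inl ?_, ?_, ?_, Or.inl rfl, Or.inl rfl⟩
  · rcases layerGraph_adj.1 hz with h | h | ⟨h, h', -⟩
    · exact Or.inr (Or.inr (Or.inl (by rw [← hi, h])))
    · omega
    · rcases LVert.eq_or_eq (u := z) h.symm hi hvw with rfl | rfl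
      · exact absurd rfl h'
      · exact Or.inl rfl
  all_goals simp [w, x, y, u, hv, LVert.ext_iff]

lemma idx_zero_or_last {l l' : List ℕ} (hl' : ∀ x ∈ l', x = 2 ∨ x = 3)
    (φ : layerGraph (chainWord l) ≃g layerGraph (chainWord l')) :
    (∀ u, u.idx = 0 → (φ u).idx = 0) ∨
      ∀ u, u.idx = 0 → (φ u).idx + 1 = (chainWord l').length := by
  have hE : ∀ u, u.idx = 0 → (φ u).idx = 0 ∨ (φ u).idx + 1 = (chainWord l').length := fun u hu =>
    ((isEndVertex_chainWord hu).map φ).idx_eq (degreesThree_chainWord hl')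
  have h6 := six_le_length_chainWord l'
  obtain ⟨r, hr⟩ := exists_lvert (W := chainWord l) (i := 0)
    (by have := six_le_length_chainWord l; omega)
  have hadj : ∀ u, u.idx = 0 → (φ u).idx ≤ (φ r).idx + 1 ∧ (φ r).idx ≤ (φ u).idx + 1 := by
    intro u hu
    by_cases h : u.side = r.side
    · rw [LVert.ext (hu.trans hr.symm) h]
      omega
    · have : (layerGraph (chainWord l)).Adj u r :=
        Or.inr (Or.inr ⟨hu.trans hr.symm, h, by rw [hu]; rfl⟩)
      rcases layerGraph_adj.1 (φ.map_adj_iff.2 this) with h | h | ⟨h, -⟩ <;> omega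
  rcases hE r hr with h | h
  · refine Or.inl fun u hu => ?_
    have h1 := hadj u hu
    have h2 := hE u hu
    omega
  · refine Or.inr fun u hu => ?_
    have h1 := hadj u hu
    have h2 := hE u hu
    omega

lemma idx_eq_iff (φ : layerGraph W ≃g layerGraph W')
    (h0 : ∀ u, u.idx = 0 ↔ (φ u).idx = 0) (i : ℕ) : ∀ u, u.idx = i ↔ (φ u).idx = i := by
  have key : ∀ {W : List Layer} (u : LVert W) (j : ℕ), u.idx = j + 1 ↔ ¬ u.idx < j + 1 ∧
      ∃ w, w.idx = j ∧ (layerGraph W).Adj u w := by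
    intro W u j
    constructor
    · intro h
      obtain ⟨w, hw⟩ := exists_lvert (W := W) (i := j) (by have := u.lt_length; omega)
      exact ⟨by omega, w, hw, Or.inr (Or.inl (by omega))⟩
    · rintro ⟨h1, w, rfl, h | h | ⟨h, -⟩⟩ <;> omega
  induction i using Nat.strong_induction_on with
  | _ i ih =>
    intro u
    cases i with
    | zero => exact h0 u
    | succ j =>
      have hlt : u.idx < j + 1 ↔ (φ u).idx < j + 1 :=
        ⟨fun h => by rwa [(ih _ h u).1 rfl], fun h => by rwa [(ih _ h u).2 rfl]⟩
      rw [key, key, hlt]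
      refine and_congr_right fun _ => ⟨?_, ?_⟩
      · rintro ⟨w, hw, hw'⟩
        exact ⟨φ w, (ih j (by omega) w).1 hw, φ.map_adj_iff.2 hw'⟩
      · rintro ⟨w, hw, hw'⟩
        obtain ⟨w, rfl⟩ := φ.surjective w
        exact ⟨w, (ih j (by omega) w).2 hw, φ.map_adj_iff.1 hw'⟩

lemma sizeAt_eq (φ : layerGraph W ≃g layerGraph W')
    (h0 : ∀ u, u.idx = 0 ↔ (φ u).idx = 0) (i : ℕ) : sizeAt W i = sizeAt W' i := by
  rw [← ncard_idx_eq, ← ncard_idx_eq, ← Set.ncard_image_of_injective _ φ.injective]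
  congr 1
  ext v
  constructor
  · rintro ⟨u, hu, rfl⟩
    exact (idx_eq_iff φ h0 i u).1 hu
  · intro hv
    obtain ⟨u, rfl⟩ := φ.surjective v
    exact ⟨u, (idx_eq_iff φ h0 i u).2 hv, rfl⟩

lemma eq_of_sizeAt_tailWord {l : List ℕ} (hl : ∀ x ∈ l, x = 2 ∨ x = 3) :
    ∀ {l' : List ℕ}, (∀ x ∈ l', x = 2 ∨ x = 3) →
      (∀ i, sizeAt (tailWord l) i = sizeAt (tailWord l') i) → l = l' := by
  induction l with
  | nil =>
    rintro (_ | ⟨y, l'⟩) hl' h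
    · rfl
    · rcases hl' y (by simp) with rfl | rfl
      · cases h 2
      · cases h 3
  | cons x l ih =>
    have hl1 := fun y hy => hl y (List.mem_cons_of_mem _ hy)
    rintro (_ | ⟨y, l'⟩) hl' h
    · rcases hl x (by simp) with rfl | rfl
      · cases h 2
      · cases h 3
    · have hl2 := fun z hz => hl' z (List.mem_cons_of_mem _ hz)
      rcases hl x (by simp) with rfl | rfl <;> rcases hl' y (by simp) with rfl | rfl
      · rw [ih hl1 hl2 fun i => h (i + 3)]
      · cases h 2
      · cases h 2
      · rw [ih hl1 hl2 fun i => h (i + 4)]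

lemma eq_of_iso {l l' : List ℕ} (hl : ∀ x ∈ l, x = 2 ∨ x = 3) (hl' : ∀ x ∈ l', x = 2 ∨ x = 3)
    (φ : layerGraph (chainWord l) ≃g layerGraph (chainWord l'))
    (h : ∀ u, u.idx = 0 → (φ u).idx = 0) : l = l' := by
  have hsymm : ∀ u, u.idx = 0 → (φ.symm u).idx = 0 := by
    refine (idx_zero_or_last hl φ.symm).resolve_right fun hlast => ?_
    obtain ⟨r, hr⟩ := exists_lvert (W := chainWord l) (i := 0)
      (by have := six_le_length_chainWord l; omega)
    have := hlast _ (h r hr)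
    rw [φ.symm_apply_apply] at this
    have := six_le_length_chainWord l
    omega
  refine eq_of_sizeAt_tailWord hl hl' fun i => ?_
  refine sizeAt_eq φ (fun u => ⟨h u, fun hu => ?_⟩) (i + 3)
  rw [← φ.symm_apply_apply u]
  exact hsymm _ hu

lemma eq_or_eq_reverse_of_iso {l l' : List ℕ} (hl : ∀ x ∈ l, x = 2 ∨ x = 3)
    (hl' : ∀ x ∈ l', x = 2 ∨ x = 3)
    (φ : layerGraph (chainWord l) ≃g layerGraph (chainWord l')) : l = l' ∨ l = l'.reverse := by
  rcases idx_zero_or_last hl' φ with h | h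
  · exact Or.inl (eq_of_iso hl hl' φ h)
  · refine Or.inr (eq_of_iso hl (by simpa using hl')
      (φ.trans (layerGraphFlip (chainWord_reverse l').symm)) fun u hu => ?_)
    have := h u hu
    simp only [RelIso.trans_apply, layerGraphFlip_idx]
    omega

end Uniqueness

lemma IsRegular'.of_iso {V V' : Type*} {G : SimpleGraph V} {G' : SimpleGraph V'} (φ : G ≃g G')
    {r : ℕ} (h : IsRegular' G r) : IsRegular' G' r := by
  intro v
  obtain ⟨v, rfl⟩ := φ.surjective v
  rw [← h v, ← Set.ncard_image_of_injective _ φ.injective]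
  congr 1
  ext u
  obtain ⟨u, rfl⟩ := φ.surjective u
  simp [φ.injective.eq_iff, φ.map_adj_iff]

lemma IsPermGraph.of_iso {V V' : Type*} {G : SimpleGraph V} {G' : SimpleGraph V'} (φ : G ≃g G')
    (h : IsPermGraph G) : IsPermGraph G' := by
  obtain ⟨n, π, ⟨e⟩⟩ := h
  exact ⟨n, π, ⟨φ.symm.trans e⟩⟩

lemma IsPermGraph.exists_isRealizer {V : Type*} [Finite V] {G : SimpleGraph V}
    (h : IsPermGraph G) : ∃ p q : V → ℕ, IsRealizer G (Nat.card V) p q := by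
  obtain ⟨n, π, ⟨e⟩⟩ := h
  obtain rfl : Nat.card V = n := by simpa using Nat.card_congr e.toEquiv
  refine ⟨fun v => (e v).val, fun v => (π (e v)).val, fun v => (e v).isLt, fun v => (π (e v)).isLt,
    fun u v huv => e.injective (Fin.ext huv),
    fun u v huv => e.injective (π.injective (Fin.ext huv)),
    fun i hi => ⟨e.symm ⟨i, hi⟩, by simp⟩, fun i hi => ⟨e.symm (π.symm ⟨i, hi⟩), by simp⟩,
    fun u v => ?_⟩
  refine (e.map_adj_iff.symm.trans (SimpleGraph.fromRel_adj _ _ _)).trans ?_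
  refine ⟨fun h => h.2, fun h => ⟨fun h' => ?_, h⟩⟩
  rw [h'] at h
  omega

lemma exists_chainWord_iso {V : Type*} [Finite V] {G : SimpleGraph V} (hc : G.Connected)
    (hG : IsRegular' G 3) (hp : IsPermGraph G) (hn : 6 < Nat.card V) :
    ∃ l : List ℕ, (∀ x ∈ l, x = 2 ∨ x = 3) ∧ Nat.card V = 10 + 2 * l.sum ∧
      Nonempty (layerGraph (chainWord l) ≃g G) := by
  obtain ⟨p, q, h⟩ := hp.exists_isRealizer
  obtain ⟨l, L, hl, hsum, hL, hlay⟩ := exists_layering hc hG h hn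
  obtain ⟨r, -⟩ := exists_lvert (W := chainWord l) (i := 0)
    (by have := six_le_length_chainWord l; omega)
  exact ⟨l, hl, hsum, hlay.nonempty_iso hL ⟨r⟩ hc (by rw [card_lvert_chainWord hl, hsum])⟩

lemma exists_fin_iso {l : List ℕ} (hl : ∀ x ∈ l, x = 2 ∨ x = 3) {n : ℕ} (hn : n = 10 + 2 * l.sum) :
    ∃ H : {G : SimpleGraph (Fin n) // G.Connected ∧ IsRegular' G 3 ∧ IsPermGraph G},
      Nonempty (layerGraph (chainWord l) ≃g H.1) := by
  have e := Finite.equivFinOfCardEq ((card_lvert_chainWord hl).trans hn.symm)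
  have φ := SimpleGraph.Iso.map e (layerGraph (chainWord l))
  exact ⟨⟨_, φ.connected_iff.1 (layerGraph_connected
    (by have := six_le_length_chainWord l; omega)), (isRegular_chainWord hl).of_iso φ,
    (isPermGraph_layerGraph _).of_iso φ⟩, ⟨φ⟩⟩

lemma two_mul_card_eq {α β : Type*} [Fintype α] [Fintype β] [DecidableEq α] [DecidableEq β]
    {r : α → α} (hr : Function.Involutive r) {f : α → β} (hf : Function.Surjective f)
    (h : ∀ x y, f x = f y ↔ x = y ∨ x = r y) :
    2 * Fintype.card β = Fintype.card α + (Finset.univ.filter fun x => r x = x).card := by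
  rw [← Finset.card_univ (α := α), Finset.card_eq_sum_card_fiberwise (f := f) (t := Finset.univ)
    fun _ _ => by simp, Finset.card_eq_sum_card_fiberwise (f := f) (t := Finset.univ)
    (s := Finset.univ.filter fun x => r x = x) fun _ _ => by simp, ← Finset.sum_add_distrib,
    Finset.sum_congr rfl (g := fun _ => 2), Finset.sum_const, Finset.card_univ, smul_eq_mul,
    mul_comm]
  intro b _
  obtain ⟨a, rfl⟩ := hf b
  by_cases ha : r a = a
  · have h1 : (Finset.univ.filter fun x => f x = f a) = {a} := by
      ext x; simp [h, ha]
    have h2 : ((Finset.univ.filter fun x => r x = x).filter fun x => f x = f a) = {a} := by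
      ext x; simp only [Finset.mem_filter, Finset.mem_univ, true_and, h, ha, or_self,
        Finset.mem_singleton]
      exact ⟨fun h => h.2, fun h => ⟨by rw [h, ha], h⟩⟩
    rw [h1, h2]
    rfl
  · have h1 : (Finset.univ.filter fun x => f x = f a) = {a, r a} := by
      ext x; simp [h]
    have h2 : ((Finset.univ.filter fun x => r x = x).filter fun x => f x = f a) = ∅ := by
      ext x
      simp only [Finset.mem_filter, Finset.mem_univ, true_and, h, Finset.notMem_empty, iff_false]
      rintro ⟨hx, rfl | rfl⟩
      · exact ha hx
      · exact ha (hr.injective hx)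
    rw [h1, h2, Finset.card_pair (Ne.symm ha)]
    rfl

/-- The compositions of a number into parts of size `2` or `3`. -/
def comps : ℕ → Finset (List ℕ)
  | 0 => {[]}
  | 1 => ∅
  | 2 => {[2]}
  | m + 3 => (comps (m + 1)).image (List.cons 2) ∪ (comps m).image (List.cons 3)

lemma mem_comps {l : List ℕ} : ∀ {m : ℕ}, l ∈ comps m ↔ (∀ p ∈ l, p = 2 ∨ p = 3) ∧ l.sum = m := by
  induction l with
  | nil =>
    intro m
    match m with
    | 0 | 1 | 2 => simp [comps]
    | m + 3 => simp [comps]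
  | cons x l ih =>
    intro m
    match m with
    | 0 | 1 =>
      simp only [comps, List.sum_cons, List.forall_mem_cons]
      simp
      omega
    | 2 =>
      have := ih (m := 0)
      simp only [comps, Finset.mem_singleton] at this
      simp only [comps, Finset.mem_singleton, List.sum_cons, List.forall_mem_cons, List.cons.injEq,
        this]
      constructor
      · rintro ⟨rfl, h1, h2⟩
        exact ⟨⟨Or.inl rfl, h1⟩, by omega⟩
      · rintro ⟨⟨rfl | rfl, h1⟩, h2⟩
        · exact ⟨rfl, h1, by omega⟩
        · omega
    | m + 3 =>
      simp only [comps, Finset.mem_union, Finset.mem_image, List.cons.injEq, List.sum_cons,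
        List.forall_mem_cons]
      constructor
      · rintro (⟨_, h, rfl, rfl⟩ | ⟨_, h, rfl, rfl⟩)
        · obtain ⟨h1, h2⟩ := ih.1 h
          exact ⟨⟨Or.inl rfl, h1⟩, by omega⟩
        · obtain ⟨h1, h2⟩ := ih.1 h
          exact ⟨⟨Or.inr rfl, h1⟩, by omega⟩
      · rintro ⟨⟨rfl | rfl, h1⟩, h2⟩
        · exact Or.inl ⟨l, ih.2 ⟨h1, by omega⟩, rfl, rfl⟩
        · exact Or.inr ⟨l, ih.2 ⟨h1, by omega⟩, rfl, rfl⟩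

lemma numComp23_eq (m : ℕ) : numComp23 m = (comps m).card := by
  simp only [numComp23, ← mem_comps]
  exact Nat.card_eq_fintype_card.trans (Fintype.card_coe _)

lemma card_comps_add_three (m : ℕ) :
    (comps (m + 3)).card = (comps (m + 1)).card + (comps m).card := by
  rw [comps, Finset.card_union_of_disjoint, Finset.card_image_of_injective _ List.cons_injective,
    Finset.card_image_of_injective _ List.cons_injective]
  simp [Finset.disjoint_left]

/-- The palindromic compositions of a number into parts of size `2` or `3`. -/
def palComps (m : ℕ) : Finset (List ℕ) := (comps m).filter fun l => l.reverse = l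

lemma palComps_add_six (m : ℕ) : palComps (m + 6) =
    (palComps (m + 2)).image (fun l => 2 :: (l ++ [2])) ∪
      (palComps m).image (fun l => 3 :: (l ++ [3])) := by
  ext l
  simp only [palComps, Finset.mem_union, Finset.mem_image, Finset.mem_filter, mem_comps]
  constructor
  · rintro ⟨⟨h1, h2⟩, h3⟩
    have hl := List.Palindrome.of_reverse_eq h3
    cases hl with
    | nil => simp at h2
    | singleton x =>
      have := h1 x (by simp)
      simp at h2
      omega
    | @cons_concat x l hl =>
      have hv : ∀ p ∈ l, p = 2 ∨ p = 3 := fun p hp => h1 p (by simp [hp])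
      simp only [List.sum_cons, List.sum_append, List.sum_nil] at h2
      rcases h1 x (by simp) with rfl | rfl
      · exact Or.inl ⟨l, ⟨⟨hv, by omega⟩, hl.reverse_eq⟩, rfl⟩
      · exact Or.inr ⟨l, ⟨⟨hv, by omega⟩, hl.reverse_eq⟩, rfl⟩
  · rintro (⟨l, ⟨⟨h1, h2⟩, h3⟩, rfl⟩ | ⟨l, ⟨⟨h1, h2⟩, h3⟩, rfl⟩)
    · refine ⟨⟨?_, ?_⟩, by simp [h3]⟩
      · simp only [List.mem_cons, List.mem_append, List.not_mem_nil, or_false]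
        rintro p (rfl | h | rfl)
        exacts [Or.inl rfl, h1 p h, Or.inl rfl]
      · simp only [List.sum_cons, List.sum_append, List.sum_nil]
        omega
    · refine ⟨⟨?_, ?_⟩, by simp [h3]⟩
      · simp only [List.mem_cons, List.mem_append, List.not_mem_nil, or_false]
        rintro p (rfl | h | rfl)
        exacts [Or.inr rfl, h1 p h, Or.inr rfl]
      · simp only [List.sum_cons, List.sum_append, List.sum_nil]
        omega

lemma card_palComps_add_six (m : ℕ) :
    (palComps (m + 6)).card = (palComps (m + 2)).card + (palComps m).card := by
  have hinj : ∀ x : ℕ, Function.Injective fun l : List ℕ => x :: (l ++ [x]) := fun x l l' h => by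
    simpa using h
  rw [palComps_add_six, Finset.card_union_of_disjoint, Finset.card_image_of_injective _ (hinj 2),
    Finset.card_image_of_injective _ (hinj 3)]
  simp [Finset.disjoint_left]

lemma card_palComps (k : ℕ) :
    (palComps (2 * k + 2)).card = (comps (k + 1)).card + (comps k).card ∧
      (palComps (2 * k + 3)).card = (comps k).card := by
  induction k using Nat.strong_induction_on with
  | _ k ih =>
    match k with
    | 0 | 1 | 2 => decide
    | k + 3 =>
      obtain ⟨h1, h2⟩ := ih k (by omega)
      obtain ⟨h3, h4⟩ := ih (k + 1) (by omega)
      have h5 := card_palComps_add_six (2 * k + 2)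
      have h6 := card_palComps_add_six (2 * k + 3)
      have h7 := card_comps_add_three k
      have h8 := card_comps_add_three (k + 1)
      rw [show 2 * (k + 3) + 2 = 2 * k + 2 + 6 by ring, show 2 * (k + 3) + 3 = 2 * k + 3 + 6 by ring]
      rw [show 2 * k + 2 + 2 = 2 * (k + 1) + 2 by ring] at h5
      rw [show 2 * k + 3 + 2 = 2 * (k + 1) + 3 by ring] at h6
      rw [show k + 1 + 3 = k + 3 + 1 by ring] at h8
      omega

lemma two_mul_numCubicPerm (m : ℕ) :
    2 * numCubicPerm (10 + 2 * m) = (comps m).card + (palComps m).card := by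
  classical
  choose F hF using fun l : comps m =>
    exists_fin_iso (l := l.1) (mem_comps.1 l.2).1 (n := 10 + 2 * m) (by rw [(mem_comps.1 l.2).2])
  let f : comps m → Quotient (cubicPermSetoid (10 + 2 * m)) := fun l => Quotient.mk _ (F l)
  let r : comps m → comps m := fun l => ⟨l.1.reverse, by
    have := mem_comps.1 l.2
    rw [mem_comps]
    simpa using this⟩
  have hr : Function.Involutive r := fun l => Subtype.ext (List.reverse_reverse _)
  have hf : Function.Surjective f := by
    intro c
    induction c using Quotient.inductionOn with
    | _ G =>
    obtain ⟨G, hc, hG, hp⟩ := G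
    obtain ⟨l, hl, hsum, ⟨φ⟩⟩ := exists_chainWord_iso hc hG hp (by simp; omega)
    rw [Nat.card_fin] at hsum
    refine ⟨⟨l, mem_comps.2 ⟨hl, by omega⟩⟩, Quotient.sound ?_⟩
    obtain ⟨ψ⟩ := hF ⟨l, mem_comps.2 ⟨hl, by omega⟩⟩
    exact ⟨ψ.symm.trans φ⟩
  have hfr : ∀ l l', f l = f l' ↔ l = l' ∨ l = r l' := by
    intro l l'
    obtain ⟨ψ⟩ := hF l
    obtain ⟨ψ'⟩ := hF l'
    constructor
    · intro h
      obtain ⟨φ⟩ := Quotient.exact h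
      rcases eq_or_eq_reverse_of_iso (mem_comps.1 l.2).1 (mem_comps.1 l'.2).1
        ((ψ.trans φ).trans ψ'.symm) with h | h
      · exact Or.inl (Subtype.ext h)
      · exact Or.inr (Subtype.ext h)
    · rintro (rfl | rfl)
      · rfl
      · refine Quotient.sound ⟨(ψ.symm.trans (layerGraphFlip ?_)).trans ψ'⟩
        rw [chainWord_reverse]
        exact congrArg chainWord (List.reverse_reverse _).symm
  have := Finite.of_surjective f hf
  have := Fintype.ofFinite (Quotient (cubicPermSetoid (10 + 2 * m)))
  rw [numCubicPerm, Nat.card_eq_fintype_card, two_mul_card_eq hr hf hfr, Fintype.card_coe]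
  congr 1
  refine Finset.card_bij (fun l _ => l.1) ?_ (fun _ _ _ _ h => Subtype.ext h) ?_
  · intro l hl
    exact Finset.mem_filter.2 ⟨l.2, congrArg Subtype.val (Finset.mem_filter.1 hl).2⟩
  · intro l hl
    obtain ⟨h1, h2⟩ := Finset.mem_filter.1 hl
    exact ⟨⟨l, h1⟩, Finset.mem_filter.2 ⟨Finset.mem_univ _, Subtype.ext h2⟩, rfl⟩

/-- Recursion for the number `a n` of connected 3-regular permutation graphs on `n`
vertices, for even `n > 20`. -/
theorem cubic_permutation_graph_count (n : ℕ) (hn : 20 < n) (he : Even n) :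
    (n % 4 = 2 → numCubicPerm n = numCubicPerm (n - 4) + numCubicPerm (n - 6)) ∧
    (n % 4 = 0 → numCubicPerm n =
      numCubicPerm (n - 4) + numCubicPerm (n - 6) - numComp23 ((n - 20) / 4)) := by
  constructor
  · intro h
    obtain ⟨k, rfl⟩ : ∃ k, n = 10 + 2 * (2 * k + 6) := ⟨(n - 22) / 4, by omega⟩
    rw [show 10 + 2 * (2 * k + 6) - 4 = 10 + 2 * (2 * k + 4) by omega,
      show 10 + 2 * (2 * k + 6) - 6 = 10 + 2 * (2 * k + 3) by omega]
    have h1 := two_mul_numCubicPerm (2 * k + 6)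
    have h2 := two_mul_numCubicPerm (2 * k + 4)
    have h3 := two_mul_numCubicPerm (2 * k + 3)
    have h4 := card_comps_add_three (2 * k + 3)
    have h5 := (card_palComps (k + 2)).1
    have h6 := (card_palComps (k + 1)).1
    have h7 := (card_palComps k).2
    have h8 := card_comps_add_three k
    simp only [mul_add, add_assoc, Nat.reduceMul, Nat.reduceAdd] at *
    omega
  · intro h
    obtain ⟨k, rfl⟩ : ∃ k, n = 10 + 2 * (2 * k + 7) := ⟨(n - 24) / 4, by omega⟩
    rw [show 10 + 2 * (2 * k + 7) - 4 = 10 + 2 * (2 * k + 5) by omega,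
      show 10 + 2 * (2 * k + 7) - 6 = 10 + 2 * (2 * k + 4) by omega,
      show (10 + 2 * (2 * k + 7) - 20) / 4 = k + 1 by omega, numComp23_eq]
    have h1 := two_mul_numCubicPerm (2 * k + 7)
    have h2 := two_mul_numCubicPerm (2 * k + 5)
    have h3 := two_mul_numCubicPerm (2 * k + 4)
    have h4 := card_comps_add_three (2 * k + 4)
    have h5 := (card_palComps (k + 2)).2
    have h6 := (card_palComps (k + 1)).1
    have h7 := (card_palComps (k + 1)).2
    simp only [mul_add, add_assoc, Nat.reduceMul, Nat.reduceAdd] at *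
    omega
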